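/- Let n ∈ ℕ and let C_n be the class of separable unital C*-algebras D with decomposition rank dr(D) ≤ n. If A is a separable unital C*-algebra which is a unital local C_n-algebra, then dr(A) ≤ n. -/

import Mathlib

noncomputable section
set_option linter.unusedSectionVars false

open scoped ComplexOrder Matrix.Norms.L2Operator
open Filter Topology

/-- An element of a `*`-ring is *positive* (in the C*-algebraic sense) if it has the
form `star y * y`. -/
def IsPosElem {R : Type*} [Mul R] [Star R] (a : R) : Prop :=
  ∃ y : R, a = star y * y

/-- A linear functional on a unital complex `*`-algebra is a *tracial state* if it is unital,
positive and tracial. -/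
def IsTracialState {R : Type*} [Ring R] [StarRing R] [Module ℂ R] (τ : R →ₗ[ℂ] ℂ) : Prop :=
  τ 1 = 1 ∧ (∀ x : R, 0 ≤ τ (star x * x)) ∧ ∀ a b : R, τ (a * b) = τ (b * a)

/-- A linear map between complex `*`-algebras is *completely positive* if all of its matrix
amplifications map positive elements to positive elements. -/
def IsCompletelyPositive {A B : Type*} [Ring A] [StarRing A] [Module ℂ A]
    [Ring B] [StarRing B] [Module ℂ B] (φ : A →ₗ[ℂ] B) : Prop :=
  ∀ (k : ℕ) (x : Matrix (Fin k) (Fin k) A), IsPosElem x → IsPosElem (x.map φ)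

/-- A map has *order zero* on a subset if it preserves orthogonality there. -/
def OrderZeroOn {F D : Type*} [Mul F] [Zero F] [Mul D] [Zero D] (φ : F → D) (s : Set F) : Prop :=
  ∀ e ∈ s, ∀ f ∈ s, e * f = 0 → f * e = 0 → φ e * φ f = 0 ∧ φ f * φ e = 0

/-- The finite-dimensional C*-algebra `⊕_{i=1}^s M_{r i}(ℂ)`. -/
abbrev FDBlock (s : ℕ) (r : Fin s → ℕ) : Type :=
  ∀ i : Fin s, Matrix (Fin (r i)) (Fin (r i)) ℂ

/-- The elements of `⊕_{i=1}^s M_{r i}(ℂ)` supported on the blocks with label `j`. -/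
def blockSupp {s : ℕ} {r : Fin s → ℕ} {n : ℕ} (J : Fin s → Fin (n + 1)) (j : Fin (n + 1)) :
    Set (FDBlock s r) :=
  {x | ∀ i : Fin s, J i ≠ j → x i = 0}

/-- `DecompositionRankLE n D` : the C*-algebra `D` has decomposition rank at most `n`. -/
def DecompositionRankLE (n : ℕ) (D : Type*) [NormedRing D] [StarRing D]
    [NormedAlgebra ℂ D] : Prop :=
  ∀ (S : Finset D) (ε : ℝ), 0 < ε →
    ∃ (s : ℕ) (r : Fin s → ℕ) (J : Fin s → Fin (n + 1))
      (ψ : D →ₗ[ℂ] FDBlock s r) (φ : FDBlock s r →ₗ[ℂ] D),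
      IsCompletelyPositive ψ ∧ IsCompletelyPositive φ ∧
      (∀ a : D, ‖ψ a‖ ≤ ‖a‖) ∧ (∀ x : FDBlock s r, ‖φ x‖ ≤ ‖x‖) ∧
      (∀ j : Fin (n + 1), OrderZeroOn φ (blockSupp J j)) ∧
      ∀ a ∈ S, ‖φ (ψ a) - a‖ < ε

/-- `NuclearDimensionLE n D` : the C*-algebra `D` has nuclear dimension at most `n`. -/
def NuclearDimensionLE (n : ℕ) (D : Type*) [NormedRing D] [StarRing D]
    [NormedAlgebra ℂ D] : Prop :=
  ∀ (S : Finset D) (ε : ℝ), 0 < ε →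
    ∃ (s : ℕ) (r : Fin s → ℕ) (J : Fin s → Fin (n + 1))
      (ψ : D →ₗ[ℂ] FDBlock s r) (φ : FDBlock s r →ₗ[ℂ] D),
      IsCompletelyPositive ψ ∧ IsCompletelyPositive φ ∧
      (∀ a : D, ‖ψ a‖ ≤ ‖a‖) ∧
      (∀ j : Fin (n + 1), (∀ x ∈ blockSupp J j, ‖φ x‖ ≤ ‖x‖) ∧
        OrderZeroOn φ (blockSupp J j)) ∧
      ∀ a ∈ S, ‖φ (ψ a) - a‖ < ε

/-- A bundled unital C*-algebra. -/
structure CStarAlg : Type 1 where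
  carrier : Type
  [str : CStarAlgebra carrier]

attribute [instance] CStarAlg.str

/-- The *finite saturation* of a class `𝒞` of unital C*-algebras: the smallest class
containing `𝒞` which is closed under isomorphism, finite direct sums, matrix amplifications
and corners by nonzero projections. -/
inductive FinSat (𝒞 : CStarAlg → Prop) : CStarAlg → Prop
  | base {B : CStarAlg} : 𝒞 B → FinSat 𝒞 B
  | iso {B B' : CStarAlg} : FinSat 𝒞 B → Nonempty (B'.carrier ≃⋆ₐ[ℂ] B.carrier) →
      FinSat 𝒞 B'
  | sum {B₁ B₂ B : CStarAlg} : FinSat 𝒞 B₁ → FinSat 𝒞 B₂ →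
      Nonempty (B.carrier ≃⋆ₐ[ℂ] (B₁.carrier × B₂.carrier)) → FinSat 𝒞 B
  | matrix {B B' : CStarAlg} (k : ℕ) : FinSat 𝒞 B →
      Nonempty (B'.carrier ≃⋆ₐ[ℂ] Matrix (Fin (k + 1)) (Fin (k + 1)) B.carrier) →
      FinSat 𝒞 B'
  | corner {B B' : CStarAlg} (p : B.carrier) : FinSat 𝒞 B → p ≠ 0 → p * p = p →
      star p = p →
      (∃ ι : B'.carrier →⋆ₙₐ[ℂ] B.carrier, Function.Injective ι ∧ ι 1 = p ∧
        Set.range ι = {x : B.carrier | p * x * p = x}) →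
      FinSat 𝒞 B'

/-- `A` is a *unital local `𝒞`-algebra*. -/
def IsUnitalLocalAlg (𝒞 : CStarAlg → Prop) (A : Type*) [NormedRing A] [StarRing A]
    [NormedAlgebra ℂ A] : Prop :=
  ∀ (S : Finset A) (ε : ℝ), 0 < ε →
    ∃ B : CStarAlg, FinSat 𝒞 B ∧
      ∃ φ : B.carrier →⋆ₐ[ℂ] A, ∀ a ∈ S, ∃ b : B.carrier, ‖a - φ b‖ < ε

/-- The class of separable unital C*-algebras with decomposition rank at most `n`. -/
def drClass (n : ℕ) : CStarAlg → Prop :=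
  fun B => TopologicalSpace.SeparableSpace B.carrier ∧ DecompositionRankLE n B.carrier

/-- The class of separable unital C*-algebras with nuclear dimension at most `n`. -/
def nucClass (n : ℕ) : CStarAlg → Prop :=
  fun B => TopologicalSpace.SeparableSpace B.carrier ∧ NuclearDimensionLE n B.carrier

/-- The class of separable unital C*-algebras with finite nuclear dimension. -/
def lnucClass : CStarAlg → Prop :=
  fun B => TopologicalSpace.SeparableSpace B.carrier ∧ ∃ n : ℕ, NuclearDimensionLE n B.carrier

/-- A separable unital C*-algebra has *locally finite nuclear dimension* if it is a
unital local `C_lnuc`-algebra. -/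
def HasLocallyFiniteNuclearDimension (A : Type*) [NormedRing A] [StarRing A]
    [NormedAlgebra ℂ A] : Prop :=
  IsUnitalLocalAlg lnucClass A
/-! ### Group actions and the Rokhlin property -/

/-- `α : G → (A →⋆ₐ[ℂ] A)` is an action of the group `G` on `A` by *-automorphisms. -/
def IsGroupAction {G A : Type*} [Group G] [CStarAlgebra A] (α : G → (A →⋆ₐ[ℂ] A)) : Prop :=
  (∀ a : A, α 1 a = a) ∧ ∀ (g h : G) (a : A), α g (α h a) = α (g * h) a

/-- The fixed point algebra `A^α` of an action, as a star subalgebra of `A`. -/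
def fixedPointAlgebra {G A : Type*} [Group G] [CStarAlgebra A] (α : G → (A →⋆ₐ[ℂ] A)) :
    StarSubalgebra ℂ A where
  carrier := {a : A | ∀ g : G, α g a = a}
  mul_mem' := fun {a} {b} ha hb g => by rw [map_mul, ha g, hb g]
  add_mem' := fun {a} {b} ha hb g => by rw [map_add, ha g, hb g]
  algebraMap_mem' := fun c g => by rw [AlgHomClass.commutes]
  star_mem' := fun {a} ha g => by rw [map_star, ha g]

/-- The Rokhlin property for a finite group action, expressed in terms of representing
sequences for projections in `A_∞ = (ℓ^∞(ℕ,A)/c₀(ℕ,A)) ∩ A'`. -/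
def ActionHasRokhlin {G A : Type*} [Group G] [Fintype G] [CStarAlgebra A]
    (α : G → (A →⋆ₐ[ℂ] A)) : Prop :=
  ∃ e : G → ℕ → A,
    (∀ g, ∃ M : ℝ, ∀ k, ‖e g k‖ ≤ M) ∧
    (∀ g, Tendsto (fun k => ‖e g k * e g k - e g k‖) atTop (𝓝 0)) ∧
    (∀ g, Tendsto (fun k => ‖star (e g k) - e g k‖) atTop (𝓝 0)) ∧
    (∀ g (a : A), Tendsto (fun k => ‖e g k * a - a * e g k‖) atTop (𝓝 0)) ∧
    Tendsto (fun k => ‖(∑ g : G, e g k) - 1‖) atTop (𝓝 0) ∧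
    (∀ g h, Tendsto (fun k => ‖α g (e h k) - e (g * h) k‖) atTop (𝓝 0))

/-! ### Inclusions of unital C*-algebras, conditional expectations, Watatani index -/

variable {P A : Type*}

/-- `E : A →ₗ[ℂ] P` is a conditional expectation onto the subalgebra `P` (included in `A`
via the injective unital *-homomorphism `ι`). -/
structure IsCondExpect [CStarAlgebra P] [CStarAlgebra A] (ι : P →⋆ₐ[ℂ] A)
    (E : A →ₗ[ℂ] P) : Prop where
  restricts : ∀ p : P, E (ι p) = p
  pos : ∀ x : A, IsPosElem (E (star x * x))
  bimodule : ∀ (p q : P) (x : A), E (ι p * x * ι q) = p * E x * q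

/-- `{(u i, v i)}` is a quasi-basis for the conditional expectation `E`; the existence of a
quasi-basis says precisely that `E` is of index-finite type. -/
def IsQuasiBasis [CStarAlgebra P] [CStarAlgebra A] (ι : P →⋆ₐ[ℂ] A) (E : A →ₗ[ℂ] P)
    {m : ℕ} (u v : Fin m → A) : Prop :=
  ∀ a : A, (a = ∑ i, u i * ι (E (v i * a))) ∧ (a = ∑ i, ι (E (a * u i)) * v i)

/-- The Rokhlin property for a conditional expectation of index-finite type with index
`ind = ∑ u i * v i` : there is a projection `e` in `A_∞ = (ℓ^∞(ℕ,A)/c₀(ℕ,A)) ∩ A'`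
(given by a representing sequence) with `E^∞(e) = (Index E)⁻¹ · 1` such that `x ↦ x e`
is injective on `A`. -/
def CondExpectHasRokhlin [CStarAlgebra P] [CStarAlgebra A] (ι : P →⋆ₐ[ℂ] A)
    (E : A →ₗ[ℂ] P) (ind : A) : Prop :=
  ∃ e : ℕ → A,
    (∃ M : ℝ, ∀ k, ‖e k‖ ≤ M) ∧
    Tendsto (fun k => ‖e k * e k - e k‖) atTop (𝓝 0) ∧
    Tendsto (fun k => ‖star (e k) - e k‖) atTop (𝓝 0) ∧
    (∀ a : A, Tendsto (fun k => ‖e k * a - a * e k‖) atTop (𝓝 0)) ∧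
    (∃ w : A, w * ind = 1 ∧ ind * w = 1 ∧
      Tendsto (fun k => ‖ι (E (e k)) - w‖) atTop (𝓝 0)) ∧
    (∀ x : A, Tendsto (fun k => ‖x * e k‖) atTop (𝓝 0) → x = 0)

/-! ### Cuntz comparison, dimension functions, strict comparison, almost divisibility -/

/-- Cuntz subequivalence for positive matrices over a C*-algebra (the topology on matrices
over a C*-algebra is the norm topology, which agrees with the product topology). -/
def CuntzSub {R : Type*} [NonUnitalNonAssocSemiring R] [Star R] [TopologicalSpace R]
    {m k : Type*} [Fintype m] [Fintype k] (a : Matrix m m R) (b : Matrix k k R) : Prop :=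
  ∃ v : ℕ → Matrix m k R, Tendsto (fun j => v j * b * (v j).conjTranspose) atTop (𝓝 a)

/-- `matNthRoot a j` is the (unique, if it exists) positive `j`-th root `a^{1/j}` of a
positive matrix `a` over a C*-algebra. -/
def matNthRoot {R : Type*} [Ring R] [StarRing R] {m : Type*} [Fintype m] [DecidableEq m]
    (a : Matrix m m R) (j : ℕ) : Matrix m m R :=
  open scoped Classical in
  if h : ∃ b : Matrix m m R, IsPosElem b ∧ b ^ j = a then h.choose else 0

/-- The standard extension `τ ⊗ Tr` of a functional `τ` to matrices. -/
def traceExt {R : Type*} [Ring R] [Module ℂ R] {m : Type*} [Fintype m]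
    (τ : R →ₗ[ℂ] ℂ) (x : Matrix m m R) : ℂ :=
  ∑ i, τ (x i i)

/-- The dimension function `d_τ(a) = lim_{n → ∞} τ(a^{1/n})` associated to a tracial
state `τ` (the limit exists, so it agrees with the `limsup` used here). -/
def dimFun {R : Type*} [Ring R] [StarRing R] [Module ℂ R] {m : Type*} [Fintype m]
    [DecidableEq m] (τ : R →ₗ[ℂ] ℂ) (a : Matrix m m R) : ℝ :=
  Filter.limsup (fun j : ℕ => (traceExt τ (matNthRoot a (j + 1))).re) atTop

/-- A unital C*-algebra `R` has *strict comparison* (of positive elements, with respect to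
tracial states) if `d_τ(a) < d_τ(b)` for all tracial states `τ` implies `a ≾ b`. -/
def HasStrictComparison (R : Type*) [Ring R] [StarRing R] [Module ℂ R]
    [TopologicalSpace R] : Prop :=
  ∀ (m k : ℕ) (a : Matrix (Fin m) (Fin m) R) (b : Matrix (Fin k) (Fin k) R),
    IsPosElem a → IsPosElem b →
    (∀ τ : R →ₗ[ℂ] ℂ, IsTracialState τ → dimFun τ a < dimFun τ b) →
    CuntzSub a b

/-- The Cuntz semigroup `W(R)` is *almost divisible*: for every positive contraction `a`
over `R` and every `k ≠ 0` there is `x = ⟨c⟩ ∈ W(R)` with `k ⬝ x ≤ ⟨a⟩ ≤ (k+1) ⬝ x`. -/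
def AlmostDivisible (R : Type*) [Ring R] [StarRing R] [TopologicalSpace R] : Prop :=
  ∀ (m : ℕ) (a : Matrix (Fin m) (Fin m) R),
    IsPosElem a → IsPosElem ((1 : Matrix (Fin m) (Fin m) R) - a) →
    ∀ k : ℕ, k ≠ 0 →
      ∃ (l : ℕ) (c : Matrix (Fin l) (Fin l) R), IsPosElem c ∧
        CuntzSub (Matrix.blockDiagonal fun _ : Fin k => c) a ∧
        CuntzSub a (Matrix.blockDiagonal fun _ : Fin (k + 1) => c)

/-- A unital C*-algebra is *pure* if it has strict comparison and almost divisible Cuntz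
semigroup. -/
def IsPure (R : Type*) [Ring R] [StarRing R] [Module ℂ R] [TopologicalSpace R] : Prop :=
  HasStrictComparison R ∧ AlmostDivisible R

/-- The order on projections over `R` is determined by traces. -/
def ProjOrderDeterminedByTraces (R : Type*) [Ring R] [StarRing R] [Module ℂ R] : Prop :=
  ∀ (k l : ℕ) (p : Matrix (Fin k) (Fin k) R) (q : Matrix (Fin l) (Fin l) R),
    p * p = p → star p = p → q * q = q → star q = q →
    (∀ τ : R →ₗ[ℂ] ℂ, IsTracialState τ → (traceExt τ p).re < (traceExt τ q).re) →
    ∃ v : Matrix (Fin l) (Fin k) R,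
      v.conjTranspose * v = p ∧ IsPosElem (q - v * v.conjTranspose)

/-- A unital C*-algebra has stable rank one if its invertible elements are dense. -/
def HasStableRankOne (R : Type*) [Ring R] [TopologicalSpace R] : Prop :=
  Dense {x : R | IsUnit x}

/-- A unital C*-algebra is simple if it has no nontrivial closed two-sided ideals. -/
def IsSimpleCStarAlgebra (A : Type*) [CStarAlgebra A] : Prop :=
  ∀ I : TwoSidedIdeal A, IsClosed (I : Set A) → I = ⊥ ∨ I = ⊤
/-! ### Corners `pRp` by a projection `p` -/

section CornerSection

variable {R : Type*} [Ring R] [StarRing R] [Algebra ℂ R] [StarModule ℂ R]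

/-- The corner `p R p` of a unital C*-algebra `R` by a projection `p`, as a unital
`*`-algebra with unit `p`. -/
def Corner (p : R) (_hp : p * p = p) (_hsp : star p = p) : Type _ :=
  {x : R // p * x * p = x}

namespace Corner

variable {p : R} {hp : p * p = p} {hsp : star p = p}

theorem mem_mul_left (hp : p * p = p) {x : R} (hx : p * x * p = x) : p * x = x := by
  conv_lhs => rw [← hx]
  simp only [← mul_assoc]
  rw [hp, hx]

theorem mem_mul_right (hp : p * p = p) {x : R} (hx : p * x * p = x) : x * p = x := by
  conv_lhs => rw [← hx]
  rw [mul_assoc, mul_assoc, hp, ← mul_assoc, hx]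

instance : Add (Corner p hp hsp) :=
  ⟨fun x y => ⟨x.1 + y.1, by rw [mul_add, add_mul, x.2, y.2]⟩⟩

instance : Zero (Corner p hp hsp) :=
  ⟨⟨0, by rw [mul_zero, zero_mul]⟩⟩

instance : Neg (Corner p hp hsp) :=
  ⟨fun x => ⟨-x.1, by rw [mul_neg, neg_mul, x.2]⟩⟩

instance : Mul (Corner p hp hsp) :=
  ⟨fun x y => ⟨x.1 * y.1, by
    rw [← mul_assoc p x.1 y.1, mem_mul_left hp x.2, mul_assoc x.1 y.1 p,
      mem_mul_right hp y.2]⟩⟩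

instance : One (Corner p hp hsp) :=
  ⟨⟨p, by rw [hp, hp]⟩⟩

instance : SMul ℂ (Corner p hp hsp) :=
  ⟨fun c x => ⟨c • x.1, by rw [mul_smul_comm, smul_mul_assoc, x.2]⟩⟩

instance : Star (Corner p hp hsp) :=
  ⟨fun x => ⟨star x.1, by
    conv_rhs => rw [← x.2]
    rw [star_mul, star_mul, hsp, ← mul_assoc]⟩⟩

@[simp] theorem val_add (x y : Corner p hp hsp) : (x + y).1 = x.1 + y.1 := rfl
@[simp] theorem val_mul (x y : Corner p hp hsp) : (x * y).1 = x.1 * y.1 := rfl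
@[simp] theorem val_zero : (0 : Corner p hp hsp).1 = 0 := rfl
@[simp] theorem val_one : (1 : Corner p hp hsp).1 = p := rfl
@[simp] theorem val_neg (x : Corner p hp hsp) : (-x).1 = -x.1 := rfl
@[simp] theorem val_smul (c : ℂ) (x : Corner p hp hsp) : (c • x).1 = c • x.1 := rfl
@[simp] theorem val_star (x : Corner p hp hsp) : (star x).1 = star x.1 := rfl

instance instRing : Ring (Corner p hp hsp) where
  add_assoc x y z := Subtype.ext <| by simp [add_assoc]
  zero_add x := Subtype.ext <| by simp
  add_zero x := Subtype.ext <| by simp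
  add_comm x y := Subtype.ext <| by simp [add_comm]
  neg_add_cancel x := Subtype.ext <| by simp
  nsmul := nsmulRec
  zsmul := zsmulRec
  mul_assoc x y z := Subtype.ext <| by simp [mul_assoc]
  one_mul x := Subtype.ext <| by simpa using mem_mul_left hp x.2
  mul_one x := Subtype.ext <| by simpa using mem_mul_right hp x.2
  left_distrib x y z := Subtype.ext <| by simp [left_distrib]
  right_distrib x y z := Subtype.ext <| by simp [right_distrib]
  zero_mul x := Subtype.ext <| by simp
  mul_zero x := Subtype.ext <| by simp

instance instStarRing : StarRing (Corner p hp hsp) where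
  star_involutive x := Subtype.ext <| by simp
  star_mul x y := Subtype.ext <| by simp
  star_add x y := Subtype.ext <| by simp

instance instModule : Module ℂ (Corner p hp hsp) where
  one_smul x := Subtype.ext <| by simp
  mul_smul c d x := Subtype.ext <| by simp [mul_smul]
  smul_zero c := Subtype.ext <| by simp
  smul_add c x y := Subtype.ext <| by simp
  add_smul c d x := Subtype.ext <| by simp [add_smul]
  zero_smul x := Subtype.ext <| by simp

instance instTop [TopologicalSpace R] : TopologicalSpace (Corner p hp hsp) :=
  instTopologicalSpaceSubtype

end Corner

end CornerSection

/-! ### Sequence algebras: `A^∞ = ℓ^∞(ℕ, A)/c₀(ℕ, A)` via representing sequences -/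

/-- A sequence in a normed space is null (i.e. lies in `c₀(ℕ, A)`). -/
def IsNullSeq {A : Type*} [Norm A] (x : ℕ → A) : Prop :=
  Tendsto (fun n => ‖x n‖) atTop (𝓝 0)

/-- A sequence in a normed space is bounded (i.e. lies in `ℓ^∞(ℕ, A)`). -/
def IsBddSeq {A : Type*} [Norm A] (x : ℕ → A) : Prop :=
  ∃ M : ℝ, ∀ n, ‖x n‖ ≤ M

/-- A linear map `β : A →ₗ[ℂ] ℓ^∞(ℕ, P)` represents a unital *-homomorphism
`A → P^∞ = ℓ^∞(ℕ, P)/c₀(ℕ, P)` : it takes values in bounded sequences and is unital,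
multiplicative and star-preserving modulo `c₀(ℕ, P)`. -/
structure RepresentsHomToSeqAlg {A P : Type*} [CStarAlgebra A] [CStarAlgebra P]
    (β : A →ₗ[ℂ] (ℕ → P)) : Prop where
  bdd : ∀ x : A, IsBddSeq (β x)
  unital : IsNullSeq (β 1 - 1)
  mul : ∀ x y : A, IsNullSeq (β (x * y) - β x * β y)
  star : ∀ x : A, IsNullSeq (β (star x) - star (β x))

/-- A Banach limit: a linear functional on (bounded) complex sequences which is unital,
shift-invariant, positive and bounded. -/
structure IsBanachLimit (L : (ℕ → ℂ) →ₗ[ℂ] ℂ) : Prop where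
  unital : L 1 = 1
  shift : ∀ x : ℕ → ℂ, IsBddSeq x → L (fun n => x (n + 1)) = L x
  pos : ∀ x : ℕ → ℂ, IsBddSeq x → (∀ n, 0 ≤ x n) → 0 ≤ L x
  norm_le : ∀ (x : ℕ → ℂ) (M : ℝ), (∀ n, ‖x n‖ ≤ M) → ‖L x‖ ≤ M

/-- A C*-algebra is *exact* iff it is nuclearly embeddable (Kirchberg): it admits a faithful
representation `π : A → B(H)` which approximately factors through matrix algebras by
completely positive contractions in the point-norm topology. -/
def IsExactCStar (A : Type*) [CStarAlgebra A] : Prop :=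
  ∃ (H : Type) (_ : NormedAddCommGroup H) (_ : InnerProductSpace ℂ H) (_ : CompleteSpace H)
    (π : A →⋆ₐ[ℂ] (H →L[ℂ] H)), Function.Injective π ∧
      ∀ (S : Finset A) (ε : ℝ), 0 < ε →
        ∃ (k : ℕ) (ψ : A →ₗ[ℂ] Matrix (Fin k) (Fin k) ℂ)
          (φ : Matrix (Fin k) (Fin k) ℂ →ₗ[ℂ] (H →L[ℂ] H)),
          IsCompletelyPositive ψ ∧ IsCompletelyPositive φ ∧
          (∀ a : A, ‖ψ a‖ ≤ ‖a‖) ∧ (∀ x, ‖φ x‖ ≤ ‖x‖) ∧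
          ∀ a ∈ S, ‖φ (ψ a) - π a‖ < ε

attribute [local instance] CStarAlgebra.spectralOrder CStarAlgebra.spectralOrderedRing

section Tools
variable {D E F : Type*} [CStarAlgebra D] [CStarAlgebra E] [CStarAlgebra F]

theorem posElem_iff (a : D) : IsPosElem a ↔ 0 ≤ a := by
  rw [CStarAlgebra.nonneg_iff_eq_star_mul_self]; rfl

theorem IsPosElem.map_hom {R S : Type*} [NonUnitalNonAssocSemiring R] [Star R] [Module ℂ R] [NonUnitalNonAssocSemiring S] [Star S] [Module ℂ S]
    (f : R →⋆ₙₐ[ℂ] S) {a : R} (h : IsPosElem a) : IsPosElem (f a) := by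
  obtain ⟨y, rfl⟩ := h
  exact ⟨f y, by simp [map_star]⟩

theorem IsPosElem.matrix_add {ι : Type} [Fintype ι] [DecidableEq ι] {x y : Matrix ι ι D}
    (hx : IsPosElem x) (hy : IsPosElem y) : IsPosElem (x + y) := by
  let e : Matrix ι ι D ≃⋆ₐ[ℂ] CStarMatrix ι ι D := CStarMatrix.ofMatrixStarAlgEquiv
  obtain ⟨a, rfl⟩ := hx
  obtain ⟨b, rfl⟩ := hy
  have h : IsPosElem (e (star a * a + star b * b)) := by
    rw [posElem_iff, map_add, map_mul, map_mul, map_star, map_star]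
    exact add_nonneg (star_mul_self_nonneg _) (star_mul_self_nonneg _)
  obtain ⟨c, hc⟩ := h
  refine ⟨e.symm c, EquivLike.injective e ?_⟩
  rw [hc]; simp [map_star]

theorem IsPosElem.reindex {R : Type*} [Ring R] [StarRing R] {ι κ : Type*} [Fintype ι] [Fintype κ]
    (e : ι ≃ κ) {x : Matrix ι ι R} (hx : IsPosElem x) : IsPosElem (x.submatrix e.symm e.symm) := by
  obtain ⟨y, rfl⟩ := hx
  refine ⟨y.submatrix e.symm e.symm, ?_⟩
  simp [Matrix.star_eq_conjTranspose, Matrix.submatrix_mul_equiv]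

theorem cp_fintype {R S : Type*} [Ring R] [StarRing R] [Module ℂ R] [Ring S] [StarRing S] [Module ℂ S]
    {φ : R →ₗ[ℂ] S} (h : IsCompletelyPositive φ) {ι : Type*} [Fintype ι]
    {x : Matrix ι ι R} (hx : IsPosElem x) : IsPosElem (x.map φ) := by
  have e := Fintype.equivFin ι
  have h1 := (h _ _ (hx.reindex e)).reindex e.symm
  convert h1 using 1
  ext i j; simp

theorem cp_comp {R S T : Type*} [Ring R] [StarRing R] [Module ℂ R] [Ring S] [StarRing S] [Module ℂ S]
    [Ring T] [StarRing T] [Module ℂ T]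
    {φ : R →ₗ[ℂ] S} {ψ : S →ₗ[ℂ] T} (hψ : IsCompletelyPositive ψ) (h : IsCompletelyPositive φ)  :
    IsCompletelyPositive (ψ ∘ₗ φ) := by
  intro k x hx
  have := hψ k _ (h k x hx)
  rwa [Matrix.map_map] at this

theorem cp_hom' {R S : Type*} [Ring R] [StarRing R] [Module ℂ R] [Ring S] [StarRing S] [Module ℂ S]
    (φ : R →ₗ[ℂ] S) (hm : ∀ x y, φ (x * y) = φ x * φ y) (hs : ∀ x, φ (star x) = star (φ x)) :
    IsCompletelyPositive φ := by
  intro k x hx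
  obtain ⟨y, rfl⟩ := hx
  refine ⟨y.map φ, ?_⟩
  ext i j
  simp [Matrix.mul_apply, hm, hs, Matrix.star_apply]

theorem cp_conj (w : D) (φ : F →ₗ[ℂ] D) (h : IsCompletelyPositive φ) (φ' : F →ₗ[ℂ] D)
    (h' : ∀ x, φ' x = w * φ x * star w) : IsCompletelyPositive φ' := by
  intro k x hx
  obtain ⟨y, hy⟩ := h k x hx
  refine ⟨y * Matrix.diagonal (fun _ => star w), ?_⟩
  rw [star_mul, mul_assoc, ← mul_assoc (star y), ← hy]
  ext i j
  simp [Matrix.star_eq_conjTranspose, Matrix.diagonal_conjTranspose, h', mul_assoc]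

theorem cp_add {φ ψ : F →ₗ[ℂ] D} (h : IsCompletelyPositive φ) (h' : IsCompletelyPositive ψ) :
    IsCompletelyPositive (φ + ψ) := by
  intro k x hx
  have := (h k x hx).matrix_add (h' k x hx)
  have e : x.map ⇑(φ + ψ) = x.map ⇑φ + x.map ⇑ψ := by ext i j; simp
  rwa [e]

theorem cp_zero : IsCompletelyPositive (0 : F →ₗ[ℂ] D) := by
  intro k x hx
  exact ⟨0, by ext; simp⟩

theorem cp_sum {ι : Type*} (s : Finset ι) {φ : ι → F →ₗ[ℂ] D} (h : ∀ i ∈ s, IsCompletelyPositive (φ i)) :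
    IsCompletelyPositive (∑ i ∈ s, φ i) := by
  classical
  induction s using Finset.induction_on with
  | empty => simpa using cp_zero
  | insert a s ha ih =>
    rw [Finset.sum_insert ha]
    exact cp_add (h _ (by simp)) (ih fun i hi => h i (by simp [hi]))

theorem cp_smul {φ : F →ₗ[ℂ] D} (h : IsCompletelyPositive φ) (t : ℝ) (ht : 0 ≤ t) :
    IsCompletelyPositive ((t : ℂ) • φ) := by
  refine cp_conj (algebraMap ℂ D (Real.sqrt t)) φ h _ fun x => ?_
  rw [← algebraMap_star_comm, ← Algebra.commutes, ← mul_assoc, ← map_mul]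
  have : star ((Real.sqrt t : ℝ) : ℂ) = Real.sqrt t := Complex.conj_ofReal _
  rw [this, ← Complex.ofReal_mul, Real.mul_self_sqrt ht, LinearMap.smul_apply, Algebra.smul_def]

theorem cp_gram {φ : F →ₗ[ℂ] D} (h : IsCompletelyPositive φ) {ι : Type} [Fintype ι]
    (x : ι → F) (v : ι → D) :
    0 ≤ ∑ i, ∑ j, star (v i) * φ (star (x i) * x j) * v j := by
  classical
  by_cases hι : Nonempty ι
  swap
  · have : IsEmpty ι := not_nonempty_iff.mp hι
    simp
  obtain ⟨i₀⟩ := hι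
  have h1 : IsPosElem (Matrix.of fun i j => star (x i) * x j) := by
    refine ⟨Matrix.of fun i j => if i = i₀ then x j else 0, ?_⟩
    ext i j
    simp [Matrix.mul_apply, Matrix.star_apply]
  obtain ⟨y, hy⟩ := cp_fintype h h1
  have h2 : ∀ i j, φ (star (x i) * x j) = ∑ l, star (y l i) * y l j := by
    intro i j
    have := congrFun (congrFun hy i) j
    simpa [Matrix.mul_apply, Matrix.star_apply] using this
  have h3 : ∑ i, ∑ j, star (v i) * φ (star (x i) * x j) * v j
      = ∑ l, star (∑ i, y l i * v i) * (∑ j, y l j * v j) := by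
    simp_rw [h2, star_sum, Finset.sum_mul_sum, Finset.mul_sum, Finset.sum_mul, star_mul, mul_assoc]
    rw [Finset.sum_comm' (t' := Finset.univ) (s' := fun _ => Finset.univ) (by simp)]
    rw [Finset.sum_comm]
    conv_lhs => enter [2, i]; rw [Finset.sum_comm]
    rw [Finset.sum_comm]
  rw [h3]
  exact Finset.sum_nonneg fun l _ => star_mul_self_nonneg _

theorem cp_nonneg {φ : F →ₗ[ℂ] D} (h : IsCompletelyPositive φ) {a : F} (ha : 0 ≤ a) : 0 ≤ φ a := by
  obtain ⟨y, rfl⟩ := CStarAlgebra.nonneg_iff_eq_star_mul_self.mp ha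
  simpa using cp_gram h (ι := Unit) (fun _ => y) (fun _ => 1)

theorem cp_mono {φ : F →ₗ[ℂ] D} (h : IsCompletelyPositive φ) {a b : F} (hab : a ≤ b) : φ a ≤ φ b := by
  have := cp_nonneg h (sub_nonneg.mpr hab)
  rwa [map_sub, sub_nonneg] at this

theorem cp_sa {φ : F →ₗ[ℂ] D} (h : IsCompletelyPositive φ) {a : F} (ha : IsSelfAdjoint a) :
    IsSelfAdjoint (φ a) := by
  have h1 : a = a⁺ - a⁻ := (CFC.posPart_sub_negPart a ha).symm
  rw [h1, map_sub]
  exact (IsSelfAdjoint.of_nonneg (cp_nonneg h (CFC.posPart_nonneg a))).sub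
    (IsSelfAdjoint.of_nonneg (cp_nonneg h (CFC.negPart_nonneg a)))

theorem cp_star {φ : F →ₗ[ℂ] D} (h : IsCompletelyPositive φ) (a : F) : φ (star a) = star (φ a) := by
  have h1 := realPart_add_I_smul_imaginaryPart a
  have hr := cp_sa h (realPart a).2
  have hi := cp_sa h (imaginaryPart a).2
  rw [← h1]
  simp only [star_add, star_smul, map_add, map_smul, hr.star_eq, hi.star_eq, (realPart a).2.star_eq,
    (imaginaryPart a).2.star_eq]

theorem cp_one_sa {φ : F →ₗ[ℂ] D} (h : IsCompletelyPositive φ) : star (φ 1) = φ 1 := by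
  rw [← cp_star h, star_one]

theorem cp_schwarz {φ : F →ₗ[ℂ] D} (h : IsCompletelyPositive φ) (h1 : φ 1 ≤ 1) (x : F) :
    star (φ x) * φ x ≤ φ (star x * x) := by
  have := cp_gram h (ι := Fin 2) ![1, x] ![-(φ x), 1]
  simp [Fin.sum_univ_two, cp_star h, cp_one_sa h] at this
  have h2 : star (φ x) * φ 1 * φ x ≤ star (φ x) * φ x := by
    simpa using star_left_conjugate_le_conjugate h1 (φ x)
  have h3 := add_le_add this h2
  rw [← sub_nonneg] at h3 ⊢
  convert h3 using 1
  abel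

theorem cp_schwarz' {φ : F →ₗ[ℂ] D} (h : IsCompletelyPositive φ) (h1 : φ 1 ≤ 1) (x : F) :
    φ x * star (φ x) ≤ φ (x * star x) := by
  have := cp_schwarz h h1 (star x)
  simpa [cp_star h] using this

theorem star_mul_self_le (x : F) : star x * x ≤ algebraMap ℝ F (‖x‖ ^ 2) := by
  exact CStarAlgebra.star_mul_le_algebraMap_norm_sq

theorem le_of_nonneg_norm {a b : D} (ha : 0 ≤ a) (hab : a ≤ b) : ‖a‖ ≤ ‖b‖ :=
  CStarAlgebra.norm_le_norm_of_nonneg_of_le ha hab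

theorem cp_star_mul_le {φ : F →ₗ[ℂ] D} (h : IsCompletelyPositive φ) (h1 : φ 1 ≤ 1) (x : F) :
    φ (star x * x) ≤ algebraMap ℝ D (‖x‖ ^ 2) := by
  refine (cp_mono h (star_mul_self_le x)).trans ?_
  rw [Algebra.algebraMap_eq_smul_one, Algebra.algebraMap_eq_smul_one]
  have : φ ((‖x‖ ^ 2 : ℝ) • (1 : F)) = (‖x‖ ^ 2 : ℝ) • φ 1 := by
    rw [← Complex.coe_smul, map_smul, Complex.coe_smul]
  rw [this]
  exact smul_le_smul_of_nonneg_left h1 (by positivity)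

theorem norm_le_of_star_mul_le {x : D} {t : ℝ} (ht : 0 ≤ t) (h : star x * x ≤ algebraMap ℝ D (t ^ 2)) : ‖x‖ ≤ t := by
  have h1 := le_of_nonneg_norm (star_mul_self_nonneg x) h
  rw [CStarRing.norm_star_mul_self] at h1
  rcases subsingleton_or_nontrivial D with hD | hD
  · simpa [Subsingleton.elim x 0] using ht
  rw [norm_algebraMap', Real.norm_eq_abs, abs_of_nonneg (by positivity)] at h1
  nlinarith [norm_nonneg x]

theorem cp_contr {φ : F →ₗ[ℂ] D} (h : IsCompletelyPositive φ) (h1 : φ 1 ≤ 1) (x : F) : ‖φ x‖ ≤ ‖x‖ :=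
  norm_le_of_star_mul_le (norm_nonneg x) ((cp_schwarz h h1 x).trans (cp_star_mul_le h h1 x))

theorem cp_multdom {φ : F →ₗ[ℂ] D} (h : IsCompletelyPositive φ) (h1 : φ 1 ≤ 1) (y b : F) :
    ‖φ (y * b) - φ y * φ b‖ ^ 2 ≤ ‖φ (y * star y) - φ y * star (φ y)‖ * ‖b‖ ^ 2 := by
  by_cases hb : b = 0
  · simp [hb]
  set X := φ (y * b) - φ y * φ b with hX
  set Q := φ (star b * b) - star (φ b) * φ b with hQ
  set R := φ (y * star y) - φ y * star (φ y) with hR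
  set β : ℝ := ‖b‖ ^ 2 with hβ
  have hβ0 : 0 < β := by positivity
  -- positivity
  have key : ∀ v : D, 0 ≤ R + X * v + star v * star X + star v * Q * v := by
    intro v
    have g := cp_gram h (ι := Fin 3) ![1, star y, b] ![-(star (φ y) + φ b * v), 1, v]
    have hb' : φ (star b * star y) = star (φ (y * b)) := by rw [← cp_star h, star_mul]
    have g2 : star (star (φ y) + φ b * v) * φ 1 * (star (φ y) + φ b * v) ≤ 
       star (star (φ y) + φ b * v) * (star (φ y) + φ b * v) := by
      simpa using star_left_conjugate_le_conjugate h1 (star (φ y) + φ b * v)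
    have g3 := add_le_add g g2
    rw [← sub_nonneg] at g3
    convert g3 using 1
    simp [Fin.sum_univ_three, cp_star h, cp_one_sa h, hX, hQ, hR, hb']
    noncomm_ring
  have hQ1 : Q ≤ algebraMap ℝ D β := by
    refine le_trans ?_ (cp_star_mul_le h h1 b)
    rw [hQ, sub_le_self_iff]; exact star_mul_self_nonneg _
  have k1 := key (-((β⁻¹ : ℝ) • star X))
  have k2 : X * Q * star X ≤ β • (X * star X) := by
    have := star_right_conjugate_le_conjugate hQ1 X
    refine this.trans_eq ?_
    rw [Algebra.algebraMap_eq_smul_one]; simp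
  have k3 : (β⁻¹ : ℝ) • (X * star X) ≤ R := by
    have k4 : (β⁻¹ * β⁻¹ : ℝ) • (X * Q * star X) ≤ (β⁻¹ : ℝ) • (X * star X) := by
      have := smul_le_smul_of_nonneg_left k2 (a := (β⁻¹ * β⁻¹ : ℝ)) (by positivity)
      rwa [smul_smul, inv_mul_cancel_right₀ hβ0.ne'] at this
    have k5 := add_le_add k1 k4
    rw [← sub_nonneg] at k5 ⊢
    convert k5 using 1
    simp [smul_smul, mul_assoc]
    abel
  have k6 := le_of_nonneg_norm (smul_nonneg (by positivity) (mul_star_self_nonneg X)) k3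
  rw [norm_smul, CStarRing.norm_self_mul_star, Real.norm_eq_abs, abs_of_pos (by positivity)] at k6
  rw [inv_mul_le_iff₀ hβ0] at k6
  nlinarith
end Tools

section APdef

abbrev Blk {I : Type} (m : I → Type) : Type := ∀ i, Matrix (m i) (m i) ℂ

def cproj {I : Type} {m : I → Type} [∀ i, DecidableEq (m i)] {n : ℕ} (J : I → Fin (n + 1)) (j : Fin (n + 1)) : Blk m :=
  fun i => if J i = j then 1 else 0

structure APd {D F : Type*} [CStarAlgebra D] [CStarAlgebra F] {n : ℕ} (c : Fin (n + 1) → F) (φ : F →ₗ[ℂ] D)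
    (K : D → ℝ) (S : Finset D) (ε : ℝ) : Prop where
  cp : IsCompletelyPositive φ
  le_one : φ 1 ≤ 1
  near : ‖φ 1 - 1‖ ≤ ε
  soz : ∀ j x y, φ (c j * x) * φ (c j * y) = φ (c j) * φ (c j * (x * y))
  app : ∀ a ∈ S, ∃ y : F, ‖y‖ ≤ K a ∧ (∀ b, ‖φ (y * b) - a * φ b‖ ≤ ε * ‖b‖) ∧
    (∀ b, ‖φ (star y * b) - star a * φ b‖ ≤ ε * ‖b‖)

def AP (n : ℕ) (D : Type*) [CStarAlgebra D] (K : D → ℝ) (S : Finset D) (ε : ℝ) : Prop :=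
  ∃ (I : Type) (_ : Fintype I) (_ : DecidableEq I) (m : I → Type) (_ : ∀ i, Fintype (m i))
    (_ : ∀ i, DecidableEq (m i)) (J : I → Fin (n + 1)) (φ : Blk m →ₗ[ℂ] D), APd (cproj J) φ K S ε

def APb (n : ℕ) (D : Type*) [CStarAlgebra D] : Prop :=
  ∃ K : D → ℝ, ∀ (S : Finset D) (ε : ℝ), 0 < ε → AP n D K S ε

theorem blk_span {I : Type} [Fintype I] [DecidableEq I] {m : I → Type} [∀ i, Fintype (m i)] [∀ i, DecidableEq (m i)]
    (T : Submodule ℂ (Blk m)) (hT : ∀ p : Blk m, p * p = p → p ∈ T) (x : Blk m) : x ∈ T := by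
  have hx : x = ∑ i, ∑ k, ∑ l, x i k l • (Pi.single i (Matrix.single k l 1) : Blk m) := by
    ext i k l
    simp only [Finset.sum_apply, Matrix.sum_apply, Pi.smul_apply, Matrix.smul_apply]
    rw [Finset.sum_eq_single i, Finset.sum_eq_single k, Finset.sum_eq_single l]
    · simp
    · intro b _ hb; simp [Matrix.single, hb]
    · simp
    · intro b _ hb; simp [Matrix.single, hb]
    · simp
    · intro b _ hb; simp [Pi.single_eq_of_ne (Ne.symm hb)]
    · simp
  rw [hx]
  refine T.sum_mem fun i _ => T.sum_mem fun k _ => T.sum_mem fun l _ => T.smul_mem _ ?_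
  have hk : (Pi.single i (Matrix.single k k 1) : Blk m) ∈ T := by
    apply hT
    rw [← Pi.single_mul, Matrix.single_mul_single_same, one_mul]
  by_cases hkl : k = l
  · subst hkl; exact hk
  · have h2 : (Pi.single i (Matrix.single k k 1 + Matrix.single k l 1) : Blk m) ∈ T := by
      apply hT
      rw [← Pi.single_mul]
      congr 1
      rw [mul_add, add_mul, add_mul]
      simp [Matrix.single_mul_single_of_ne, Ne.symm hkl]
    have := T.sub_mem h2 hk
    rwa [Pi.single_add, add_sub_cancel_left] at this

section
variable {D E F : Type*} [CStarAlgebra D] [CStarAlgebra E] [CStarAlgebra F]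

theorem mul_zero_of_le {u v X Y : D} (hu : star u * u ≤ X) (hv : v * star v ≤ Y) (hXY : X * Y = 0) : u * v = 0 := by
  have hX : 0 ≤ X := (star_mul_self_nonneg u).trans hu
  have hY : 0 ≤ Y := (mul_star_self_nonneg v).trans hv
  set s := CFC.sqrt X with hs
  have hss : s * s = X := CFC.sqrt_mul_sqrt_self X
  have hs0 : IsSelfAdjoint s := IsSelfAdjoint.of_nonneg (CFC.sqrt_nonneg X)
  have h1 : s * Y * s = 0 := by
    have hsa : IsSelfAdjoint (s * Y * s) := by
      have := (IsSelfAdjoint.of_nonneg hY).conjugate s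
      rwa [hs0.star_eq] at this
    rw [← norm_eq_zero, ← sq_eq_zero_iff, sq, ← CStarRing.norm_star_mul_self, hsa.star_eq]
    have : s * Y * s * (s * Y * s) = s * Y * ((s * s) * Y) * s := by noncomm_ring
    rw [this, hss, hXY]; simp
  have h2 : s * v = 0 := by
    rw [← norm_eq_zero, ← sq_eq_zero_iff, sq, ← CStarRing.norm_self_mul_star, star_mul, hs0.star_eq]
    have h3 := star_right_conjugate_le_conjugate hv s
    rw [hs0.star_eq, h1] at h3
    have h4 : 0 ≤ s * (v * star v) * s := by
      simpa [hs0.star_eq] using star_right_conjugate_nonneg (mul_star_self_nonneg v) s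
    rw [norm_eq_zero, mul_assoc, ← mul_assoc v, ← mul_assoc]
    exact le_antisymm h3 h4
  rw [← norm_eq_zero, ← sq_eq_zero_iff, sq, ← CStarRing.norm_star_mul_self, star_mul]
  have h3 := star_left_conjugate_le_conjugate hu v
  rw [← hss] at h3
  rw [mul_assoc _ (s * s) v, mul_assoc s s v, h2] at h3
  have h4 : 0 ≤ star v * (star u * u) * v := star_left_conjugate_nonneg (star_mul_self_nonneg u) v
  rw [norm_eq_zero]
  simp only [mul_assoc, mul_zero] at h3 h4 ⊢
  exact le_antisymm h3 h4

theorem cproj_comm {I : Type} [Fintype I] [DecidableEq I] {m : I → Type} [∀ i, Fintype (m i)] [∀ i, DecidableEq (m i)]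
    {n : ℕ} (J : I → Fin (n + 1)) (j) (x : Blk m) : x * cproj J j = cproj J j * x := by
  funext i; by_cases h : J i = j <;> simp [cproj, h]

theorem cproj_idem {I : Type} [Fintype I] [DecidableEq I] {m : I → Type} [∀ i, Fintype (m i)] [∀ i, DecidableEq (m i)]
    {n : ℕ} (J : I → Fin (n + 1)) (j) : cproj J j * cproj J j = (cproj J j : Blk m) := by
  funext i; by_cases h : J i = j <;> simp [cproj, h]

theorem cproj_star {I : Type} [Fintype I] [DecidableEq I] {m : I → Type} [∀ i, Fintype (m i)] [∀ i, DecidableEq (m i)]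
    {n : ℕ} (J : I → Fin (n + 1)) (j) : star (cproj J j) = (cproj J j : Blk m) := by
  funext i; by_cases h : J i = j <;> simp [cproj, h]

theorem cproj_sum {I : Type} [Fintype I] [DecidableEq I] {m : I → Type} [∀ i, Fintype (m i)] [∀ i, DecidableEq (m i)]
    {n : ℕ} (J : I → Fin (n + 1)) : ∑ j, cproj J j = (1 : Blk m) := by
  funext i; rw [Finset.sum_apply, Finset.sum_eq_single (J i)] <;> simp +contextual [cproj, eq_comm]

theorem soz_of_oz {I : Type} [Fintype I] [DecidableEq I] {m : I → Type} [∀ i, Fintype (m i)] [∀ i, DecidableEq (m i)]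
    {n : ℕ} (J : I → Fin (n + 1)) {φ : Blk m →ₗ[ℂ] D} (h : IsCompletelyPositive φ) (h1 : φ 1 ≤ 1) (j : Fin (n+1))
    (hoz : OrderZeroOn φ {x | ∀ i, J i ≠ j → x i = 0}) (x y : Blk m) :
    φ (cproj J j * x) * φ (cproj J j * y) = φ (cproj J j) * φ (cproj J j * (x * y)) := by
  have hmem : ∀ x : Blk m, cproj J j * x ∈ {x : Blk m | ∀ i, J i ≠ j → x i = 0} := by
    intro x i hi; simp [cproj, hi]
  set c : Blk m := cproj J j with hc
  have hcc : c * c = c := cproj_idem J j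
  have hcm : ∀ x, x * c = c * x := cproj_comm J j
  have hcs : star c = c := cproj_star J j
  have s1 : ∀ a b : Blk m, c * a * b = 0 → φ (c * a) * φ (c * b) = 0 := by
    intro a b hab
    have hab' : (c * a) * (c * b) = 0 := by
      rw [← mul_assoc, mul_assoc c a c, hcm, ← mul_assoc, hcc, hab]
    refine mul_zero_of_le (cp_schwarz h h1 _) (cp_schwarz' h h1 _) ?_
    refine (hoz _ ?_ _ ?_ ?_ ?_).1
    · have := hmem (star (c * a) * a)
      convert this using 1
      simp only [star_mul, hcs, ← mul_assoc, hcm]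
    · have := hmem (b * star (c * b))
      convert this using 1
      simp only [← mul_assoc]
    · rw [mul_assoc, ← mul_assoc (c * a), hab']; simp
    · have : star (c * b) * star (c * a) = 0 := by rw [← star_mul, hab', star_zero]
      rw [mul_assoc, ← mul_assoc (star (c * b)), this]; simp
  let T : Submodule ℂ (Blk m) :=
    { carrier := {p | ∀ a b, φ (c * (a * p)) * φ (c * b) = φ (c * a) * φ (c * (p * b))}
      add_mem' := by
        intro p q hp hq a b
        simp only [mul_add, add_mul, map_add]
        rw [hp a b, hq a b]
      zero_mem' := by intro a b; simp
      smul_mem' := by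
        intro t p hp a b
        simp only [mul_smul_comm, smul_mul_assoc, map_smul]
        rw [hp a b] }
  have hT : ∀ p : Blk m, p ∈ T := by
    refine blk_span T fun p hp a b => ?_
    have e1 := s1 (a * p) ((1 - p) * b) (by
      rw [← mul_assoc, mul_assoc c, mul_assoc a, mul_sub, hp, mul_one, sub_self]; simp)
    have e2 := s1 (a * (1 - p)) (p * b) (by
      rw [← mul_assoc, mul_assoc c, mul_assoc a, sub_mul, hp, one_mul, sub_self]; simp)
    simp only [sub_mul, mul_sub, one_mul, mul_one, map_sub, sub_eq_zero] at e1 e2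
    rw [e1, ← e2]
  have := hT x 1 y
  simpa using this

theorem cp_one_le {φ : F →ₗ[ℂ] D} (h : IsCompletelyPositive φ) (h1 : ∀ x, ‖φ x‖ ≤ ‖x‖) : φ 1 ≤ 1 := by
  have h0 : 0 ≤ φ 1 := cp_nonneg h zero_le_one
  rw [← CStarAlgebra.norm_le_one_iff_of_nonneg _ h0]
  refine (h1 1).trans ?_
  rcases subsingleton_or_nontrivial F with hF | hF
  · simp [Subsingleton.elim (1 : F) 0]
  · simp

theorem base_aux {φ : F →ₗ[ℂ] D} {ψ : D →ₗ[ℂ] F} (hφ : IsCompletelyPositive φ) (hψ : IsCompletelyPositive ψ)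
    (h1 : φ 1 ≤ 1) (h2 : ψ 1 ≤ 1) (a : D) {δ ε : ℝ} (hε : 0 < ε) (d1 : ‖φ (ψ a) - a‖ ≤ δ)
    (d2 : ‖φ (ψ (a * star a)) - a * star a‖ ≤ δ) (hδ1 : δ ≤ ε / 2) (hδ2 : δ * (1 + 2 * ‖a‖) ≤ ε ^ 2 / 4) (b : F) :
    ‖φ (ψ a * b) - a * φ b‖ ≤ ε * ‖b‖ := by
  set y := ψ a with hy
  have n1 : ‖y‖ ≤ ‖a‖ := cp_contr hψ h2 a
  have n2 : ‖φ y‖ ≤ ‖a‖ := (cp_contr hφ h1 y).trans n1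
  have g1 : 0 ≤ φ (y * star y) - φ y * star (φ y) := sub_nonneg.mpr (cp_schwarz' hφ h1 y)
  have g2 : φ (y * star y) - φ y * star (φ y) ≤ φ (ψ (a * star a)) - φ y * star (φ y) :=
    sub_le_sub_right (cp_mono hφ (cp_schwarz' hψ h2 a)) _
  have g3 := le_of_nonneg_norm g1 g2
  have g4 : ‖φ (ψ (a * star a)) - φ y * star (φ y)‖ ≤ δ * (1 + 2 * ‖a‖) := by
    have : φ (ψ (a * star a)) - φ y * star (φ y) = (φ (ψ (a * star a)) - a * star a)
        - ((φ y - a) * star (φ y) + a * star (φ y - a)) := by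
      rw [star_sub]; noncomm_ring
    rw [this]
    refine (norm_sub_le _ _).trans ?_
    have k1 := norm_add_le ((φ y - a) * star (φ y)) (a * star (φ y - a))
    have k2 := norm_mul_le (φ y - a) (star (φ y))
    have k3 := norm_mul_le a (star (φ y - a))
    rw [norm_star] at k2 k3
    have k4 : ‖φ y - a‖ * ‖φ y‖ ≤ δ * ‖a‖ := mul_le_mul d1 n2 (norm_nonneg _) ((norm_nonneg _).trans d1)
    have k5 : ‖a‖ * ‖φ y - a‖ ≤ ‖a‖ * δ := mul_le_mul_of_nonneg_left d1 (norm_nonneg _)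
    linarith
  have g5 := cp_multdom hφ h1 y b
  have g6 : ‖φ (y * b) - φ y * φ b‖ ≤ ε / 2 * ‖b‖ := by
    apply le_of_sq_le_sq _ (by positivity)
    refine g5.trans ?_
    have : (ε / 2 * ‖b‖) ^ 2 = ε ^ 2 / 4 * ‖b‖ ^ 2 := by ring
    rw [this]
    exact mul_le_mul_of_nonneg_right (by linarith) (by positivity)
  have g7 : ‖(φ y - a) * φ b‖ ≤ ε / 2 * ‖b‖ :=
    (norm_mul_le _ _).trans (mul_le_mul (d1.trans hδ1) (cp_contr hφ h1 b) (norm_nonneg _) (by positivity))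
  have : φ (y * b) - a * φ b = (φ (y * b) - φ y * φ b) + (φ y - a) * φ b := by noncomm_ring
  rw [this]
  refine (norm_add_le _ _).trans ?_
  linarith

theorem ap_base {D : Type*} [CStarAlgebra D] {n : ℕ} (h : DecompositionRankLE n D) : APb n D := by
  classical
  refine ⟨fun a => ‖a‖, fun S ε hε => ?_⟩
  set M : ℝ := ∑ a ∈ S, ‖a‖ with hM
  have hM0 : 0 ≤ M := Finset.sum_nonneg fun _ _ => norm_nonneg _
  set δ : ℝ := min (ε / 2) (ε ^ 2 / 4 / (1 + 2 * M)) with hδ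
  have hδ0 : 0 < δ := by positivity
  obtain ⟨s, r, J, ψ, φ, hψ, hφ, cψ, cφ, hoz, happ⟩ :=
    h (insert 1 (S ∪ S.image star ∪ S.image (fun a => a * star a) ∪ S.image (fun a => star a * a))) δ hδ0
  have h1 : φ 1 ≤ 1 := cp_one_le hφ cφ
  have h2 := cp_one_le hψ cψ
  refine ⟨Fin s, inferInstance, inferInstance, fun i => Fin (r i), inferInstance, inferInstance, J, φ, ?_⟩
  refine ⟨hφ, h1, ?_, fun j x y => soz_of_oz J hφ h1 j (hoz j) x y, fun a ha => ⟨ψ a, cψ a, ?_, ?_⟩⟩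
  · have k1 := cp_mono hφ h2
    have k2 := le_of_nonneg_norm (sub_nonneg.mpr h1) (sub_le_sub_left k1 1)
    rw [norm_sub_rev]
    refine k2.trans ?_
    rw [norm_sub_rev]
    have := happ 1 (by simp)
    have := min_le_left (ε / 2) (ε ^ 2 / 4 / (1 + 2 * M))
    linarith
  all_goals
    have ha' : ‖a‖ ≤ M := Finset.single_le_sum (f := fun a => ‖a‖) (fun _ _ => norm_nonneg _) ha
    have hd : δ * (1 + 2 * ‖a‖) ≤ ε ^ 2 / 4 := by
      have h3 : δ ≤ ε ^ 2 / 4 / (1 + 2 * M) := min_le_right _ _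
      rw [le_div_iff₀ (by positivity)] at h3
      refine le_trans ?_ h3
      exact mul_le_mul_of_nonneg_left (by linarith) hδ0.le
  · intro b
    refine base_aux hφ hψ h1 h2 a hε (happ a ?_).le (happ _ ?_).le (min_le_left _ _) hd b
    · simp [ha]
    · simp only [Finset.mem_insert, Finset.mem_union, Finset.mem_image]
      exact Or.inr (Or.inl (Or.inr ⟨a, ha, rfl⟩))
  · intro b
    rw [← cp_star hψ]
    refine base_aux hφ hψ h1 h2 (star a) hε (happ _ ?_).le (happ _ ?_).le (min_le_left _ _) (by rwa [norm_star]) b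
    · simp only [Finset.mem_insert, Finset.mem_union, Finset.mem_image]
      exact Or.inr (Or.inl (Or.inl (Or.inr ⟨a, ha, rfl⟩)))
    · simp only [Finset.mem_insert, Finset.mem_union, Finset.mem_image]
      exact Or.inr (Or.inr ⟨a, ha, by simp⟩)
end
end APdef

section Perm
variable {D E F D' F' : Type*} [CStarAlgebra D] [CStarAlgebra E] [CStarAlgebra F] [CStarAlgebra D'] [CStarAlgebra F']

theorem le_iff_pos (a b : D) : a ≤ b ↔ IsPosElem (b - a) := by
  rw [posElem_iff, sub_nonneg]

theorem equiv_norm (θ : D ≃⋆ₐ[ℂ] E) (x : D) : ‖θ x‖ = ‖x‖ :=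
  NonUnitalStarAlgHom.norm_map (θ : D →⋆ₐ[ℂ] E) (EquivLike.injective θ) x

theorem APd.source {n : ℕ} {c : Fin (n + 1) → F} {c' : Fin (n + 1) → F'} {φ : F →ₗ[ℂ] D} {K : D → ℝ} {S : Finset D} {ε : ℝ}
    (θ : F' ≃⋆ₐ[ℂ] F) (hc : ∀ j, θ (c' j) = c j) (h : APd c φ K S ε) :
    APd c' (φ ∘ₗ (θ : F' →ₗ[ℂ] F)) K S ε := by
  refine ⟨cp_comp h.cp (cp_hom' _ (by simp) (by simp [map_star])), ?_, ?_, ?_, ?_⟩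
  · simpa using h.le_one
  · simpa using h.near
  · intro j x y; simpa [hc] using h.soz j (θ x) (θ y)
  · intro a ha
    obtain ⟨y, hy, h1, h2⟩ := h.app a ha
    refine ⟨θ.symm y, ?_, fun b => ?_, fun b => ?_⟩
    · rwa [equiv_norm]
    · simpa [equiv_norm] using h1 (θ b)
    · simpa [equiv_norm, map_star] using h2 (θ b)

theorem hom_mono (π : D →⋆ₐ[ℂ] E) {a b : D} (h : a ≤ b) : π a ≤ π b := by
  rw [le_iff_pos] at h ⊢
  obtain ⟨y, hy⟩ := h
  exact ⟨π y, by rw [← map_star, ← map_mul, ← hy, map_sub]⟩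

theorem APd.push {n : ℕ} {c : Fin (n + 1) → F} {φ : F →ₗ[ℂ] D} {K : D → ℝ} {K' : E → ℝ} {S : Finset D} {S' : Finset E} {ε ε' : ℝ}
    (hε' : 0 ≤ ε') (π : D →⋆ₐ[ℂ] E) (h : APd c φ K S ε) (hS : ∀ a' ∈ S', ∃ a ∈ S, ‖a' - π a‖ ≤ ε' ∧ K a ≤ K' a') :
    APd c ((π : D →ₗ[ℂ] E) ∘ₗ φ) K' S' (ε + ε') := by
  have hcp : IsCompletelyPositive ((π : D →ₗ[ℂ] E) ∘ₗ φ) := cp_comp (cp_hom' _ (by simp) (by simp [map_star])) h.cp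
  have hle : ((π : D →ₗ[ℂ] E) ∘ₗ φ) 1 ≤ 1 := by simpa using hom_mono π h.le_one
  have hn : ∀ x, ‖π x‖ ≤ ‖x‖ := NonUnitalStarAlgHom.norm_apply_le π
  refine ⟨hcp, hle, ?_, ?_, ?_⟩
  · have := (hn (φ 1 - 1)).trans h.near
    simp at this ⊢
    linarith
  · intro j x y; simpa using congrArg π (h.soz j x y)
  · intro a' ha'
    obtain ⟨a, ha, ha1, hK⟩ := hS a' ha'
    obtain ⟨y, hy, h1, h2⟩ := h.app a ha
    have aux : ∀ (u : F) (z : D) (z' : E) (b : F), ‖φ (u * b) - z * φ b‖ ≤ ε * ‖b‖ → ‖z' - π z‖ ≤ ε' → 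
       ‖π (φ (u * b)) - z' * π (φ b)‖ ≤ (ε + ε') * ‖b‖ := by
      intro u z z' b h3 h4
      have : π (φ (u * b)) - z' * π (φ b) = π (φ (u * b) - z * φ b) - (z' - π z) * π (φ b) := by
        simp only [map_sub, map_mul]; noncomm_ring
      rw [this]
      refine (norm_sub_le _ _).trans ?_
      have k1 := (hn _).trans h3
      have k2 := norm_mul_le (z' - π z) (π (φ b))
      have k3 : ‖z' - π z‖ * ‖π (φ b)‖ ≤ ε' * ‖b‖ :=
        mul_le_mul h4 (by simpa using cp_contr hcp hle b) (norm_nonneg _) hε'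
      linarith
    refine ⟨y, hy.trans hK, fun b => aux _ a a' b (h1 b) ha1, fun b => aux _ (star a) (star a') b (h2 b) ?_⟩
    rwa [map_star, ← star_sub, norm_star]

theorem ap_iso {n : ℕ} (θ : D ≃⋆ₐ[ℂ] E) (h : APb n D) : APb n E := by
  classical
  obtain ⟨K, h⟩ := h
  refine ⟨K ∘ θ.symm, fun S ε hε => ?_⟩
  obtain ⟨I, i1, i2, m, i3, i4, J, φ, hφ⟩ := h (S.image θ.symm) ε hε
  have := hφ.push le_rfl (θ : D →⋆ₐ[ℂ] E) (S' := S) (K' := K ∘ θ.symm)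
    fun a ha => ⟨θ.symm a, Finset.mem_image_of_mem _ ha, by simp, le_rfl⟩
  rw [add_zero] at this
  exact ⟨I, i1, i2, m, i3, i4, J, _, this⟩

theorem ap_sum {n : ℕ} (h₁ : APb n D) (h₂ : APb n E) : APb n (D × E) := by
  classical
  obtain ⟨K₁, h₁⟩ := h₁
  obtain ⟨K₂, h₂⟩ := h₂
  refine ⟨fun a => max (K₁ a.1) (K₂ a.2), fun S ε hε => ?_⟩
  obtain ⟨I₁, _, _, m₁, _, _, J₁, φ₁, H₁⟩ := h₁ (S.image Prod.fst) ε hε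
  obtain ⟨I₂, _, _, m₂, _, _, J₂, φ₂, H₂⟩ := h₂ (S.image Prod.snd) ε hε
  let i3 : ∀ i, Fintype (Sum.elim m₁ m₂ i) := fun i => match i with
    | Sum.inl i => inferInstanceAs (Fintype (m₁ i))
    | Sum.inr i => inferInstanceAs (Fintype (m₂ i))
  let i4 : ∀ i, DecidableEq (Sum.elim m₁ m₂ i) := fun i => match i with
    | Sum.inl i => inferInstanceAs (DecidableEq (m₁ i))
    | Sum.inr i => inferInstanceAs (DecidableEq (m₂ i))
  let p₁ : Blk (Sum.elim m₁ m₂) →⋆ₐ[ℂ] Blk m₁ :=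
    { toFun := fun x i => x (Sum.inl i), map_one' := rfl, map_mul' := fun _ _ => rfl, map_zero' := rfl, 
      map_add' := fun _ _ => rfl, commutes' := fun _ => rfl, map_star' := fun _ => rfl }
  let p₂ : Blk (Sum.elim m₁ m₂) →⋆ₐ[ℂ] Blk m₂ :=
    { toFun := fun x i => x (Sum.inr i), map_one' := rfl, map_mul' := fun _ _ => rfl, map_zero' := rfl, 
      map_add' := fun _ _ => rfl, commutes' := fun _ => rfl, map_star' := fun _ => rfl }
  let φ : Blk (Sum.elim m₁ m₂) →ₗ[ℂ] (D × E) := 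
    LinearMap.inl ℂ D E ∘ₗ φ₁ ∘ₗ (p₁ : Blk (Sum.elim m₁ m₂) →ₗ[ℂ] Blk m₁) + LinearMap.inr ℂ D E ∘ₗ φ₂ ∘ₗ (p₂ : Blk (Sum.elim m₁ m₂) →ₗ[ℂ] Blk m₂)
  have hφ : ∀ x, φ x = (φ₁ (p₁ x), φ₂ (p₂ x)) := by intro x; simp [φ]
  have hpn₁ : ∀ x, ‖p₁ x‖ ≤ ‖x‖ := NonUnitalStarAlgHom.norm_apply_le p₁
  have hpn₂ : ∀ x, ‖p₂ x‖ ≤ ‖x‖ := NonUnitalStarAlgHom.norm_apply_le p₂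
  have hc₁ : ∀ j, p₁ (cproj (Sum.elim J₁ J₂) j) = cproj J₁ j := by intro j; rfl
  have hc₂ : ∀ j, p₂ (cproj (Sum.elim J₁ J₂) j) = cproj J₂ j := by intro j; rfl
  refine ⟨I₁ ⊕ I₂, inferInstance, inferInstance, Sum.elim m₁ m₂, i3, i4, Sum.elim J₁ J₂, φ, ?_, ?_, ?_, ?_, ?_⟩
  · refine cp_add (cp_comp (cp_hom' _ (by simp) ?_) (cp_comp H₁.cp (cp_hom' _ (by simp) (by simp [map_star])))) 
      (cp_comp (cp_hom' _ (by simp) ?_) (cp_comp H₂.cp (cp_hom' _ (by simp) (by simp [map_star]))))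
    · intro x; ext <;> simp
    · intro x; ext <;> simp
  · obtain ⟨y₁, hy₁⟩ := (le_iff_pos _ _).mp H₁.le_one
    obtain ⟨y₂, hy₂⟩ := (le_iff_pos _ _).mp H₂.le_one
    rw [le_iff_pos]
    refine ⟨(y₁, y₂), ?_⟩
    rw [hφ]; ext
    · simpa using hy₁
    · simpa using hy₂
  · rw [hφ, Prod.norm_def]
    exact max_le (by simpa using H₁.near) (by simpa using H₂.near)
  · intro j x y
    rw [hφ, hφ, hφ, hφ]
    ext
    · simpa [hc₁] using H₁.soz j (p₁ x) (p₁ y)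
    · simpa [hc₂] using H₂.soz j (p₂ x) (p₂ y)
  · intro a ha
    obtain ⟨y₁, hy₁, u₁, v₁⟩ := H₁.app a.1 (Finset.mem_image_of_mem _ ha)
    obtain ⟨y₂, hy₂, u₂, v₂⟩ := H₂.app a.2 (Finset.mem_image_of_mem _ ha)
    let y : Blk (Sum.elim m₁ m₂) := fun i => match i with
      | Sum.inl i => y₁ i
      | Sum.inr i => y₂ i
    have e₁ : p₁ y = y₁ := rfl
    have e₂ : p₂ y = y₂ := rfl
    refine ⟨y, ?_, ?_, ?_⟩
    · rw [pi_norm_le_iff_of_nonneg (le_max_of_le_left ((norm_nonneg _).trans hy₁))]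
      rintro (i | i)
      · exact (norm_le_pi_norm y₁ i).trans (le_max_of_le_left hy₁)
      · exact (norm_le_pi_norm y₂ i).trans (le_max_of_le_right hy₂)
    · intro b
      rw [hφ, hφ, Prod.norm_def]
      refine max_le ?_ ?_
      · have := (u₁ (p₁ b)).trans (mul_le_mul_of_nonneg_left (hpn₁ b) hε.le)
        simpa [e₁] using this
      · have := (u₂ (p₂ b)).trans (mul_le_mul_of_nonneg_left (hpn₂ b) hε.le)
        simpa [e₂] using this
    · intro b
      rw [hφ, hφ, Prod.norm_def]
      refine max_le ?_ ?_
      · have := (v₁ (p₁ b)).trans (mul_le_mul_of_nonneg_left (hpn₁ b) hε.le)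
        simpa [e₁, map_star] using this
      · have := (v₂ (p₂ b)).trans (mul_le_mul_of_nonneg_left (hpn₂ b) hε.le)
        simpa [e₂, map_star] using this
end Perm

section Mat
variable {D E F D' F' : Type*} [CStarAlgebra D] [CStarAlgebra E] [CStarAlgebra F] [CStarAlgebra D'] [CStarAlgebra F']
variable {k : ℕ}

theorem norm_one_le' : ‖(1 : D)‖ ≤ 1 := by
  rcases subsingleton_or_nontrivial D with h | h
  · simp [Subsingleton.elim (1 : D) 0]
  · simp

theorem mat_single_norm (Θ : E ≃⋆ₐ[ℂ] Matrix (Fin k) (Fin k) D) (a b : Fin k) (x : D) :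
    ‖Θ.symm (Matrix.single a b x)‖ = ‖x‖ := by
  let ι : D →⋆ₙₐ[ℂ] E :=
    { toFun := fun x => Θ.symm (Matrix.single b b x)
      map_smul' := fun t x => by
        rw [← map_smul]; congr 1; simp [Matrix.smul_single]
      map_zero' := by simp
      map_add' := fun x y => by rw [← map_add, Matrix.single_add]
      map_mul' := fun x y => by rw [← map_mul, Matrix.single_mul_single_same]
      map_star' := fun x => by
        rw [← map_star]; congr 1; simp [Matrix.star_eq_conjTranspose] }
  have hι : Function.Injective ι := by
    intro x y hxy
    have h1 : Θ.symm (Matrix.single b b x) = Θ.symm (Matrix.single b b y) := hxy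
    have h2 := EquivLike.injective Θ.symm h1
    simpa using congrFun (congrFun h2 b) b
  have h1 : star (Θ.symm (Matrix.single a b x)) * Θ.symm (Matrix.single a b x) = ι (star x * x) := by
    rw [← map_star, ← map_mul]
    show _ = Θ.symm (Matrix.single b b (star x * x))
    congr 1
    rw [Matrix.star_eq_conjTranspose, Matrix.conjTranspose_single, Matrix.single_mul_single_same]
  have h2 : ‖ι (star x * x)‖ = ‖star x * x‖ := NonUnitalStarAlgHom.norm_map ι hι _
  rw [← h1, CStarRing.norm_star_mul_self, CStarRing.norm_star_mul_self] at h2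
  nlinarith [norm_nonneg x, norm_nonneg (Θ.symm (Matrix.single a b x))]

theorem mat_norm_le (Θ : E ≃⋆ₐ[ℂ] Matrix (Fin k) (Fin k) D) (x : E) : ‖x‖ ≤ ∑ a, ∑ b, ‖Θ x a b‖ := by
  have : x = ∑ a, ∑ b, Θ.symm (Matrix.single a b (Θ x a b)) := by
    apply EquivLike.injective Θ
    conv_lhs => rw [Matrix.matrix_eq_sum_single (Θ x)]
    simp
  conv_lhs => rw [this]
  refine (norm_sum_le _ _).trans (Finset.sum_le_sum fun a _ => (norm_sum_le _ _).trans (Finset.sum_le_sum fun b _ => ?_))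
  rw [mat_single_norm]

theorem mat_le_norm (Θ : E ≃⋆ₐ[ℂ] Matrix (Fin k) (Fin k) D) (x : E) (a b : Fin k) : ‖Θ x a b‖ ≤ ‖x‖ := by
  rw [← mat_single_norm Θ a b]
  have : Θ.symm (Matrix.single a b (Θ x a b)) = Θ.symm (Matrix.single a a 1) * x * Θ.symm (Matrix.single b b 1) := by
    apply EquivLike.injective Θ
    simp
  rw [this]
  have h1 : ∀ a, ‖Θ.symm (Matrix.single a a 1)‖ ≤ 1 := fun a => by
    rw [mat_single_norm]; exact norm_one_le'
  calc _ ≤ ‖Θ.symm (Matrix.single a a 1)‖ * ‖x‖ * ‖Θ.symm (Matrix.single b b 1)‖ := 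
        (norm_mul_le _ _).trans (mul_le_mul_of_nonneg_right (norm_mul_le _ _) (norm_nonneg _))
    _ ≤ 1 * ‖x‖ * 1 := by gcongr <;> exact h1 _
    _ = _ := by simp

def matMapL (k : ℕ) (φ : F →ₗ[ℂ] D) : Matrix (Fin k) (Fin k) F →ₗ[ℂ] Matrix (Fin k) (Fin k) D where
  toFun M := M.map φ
  map_add' x y := by ext; simp
  map_smul' t x := by ext; simp

theorem cp_matMap {φ : F →ₗ[ℂ] D} (h : IsCompletelyPositive φ) : IsCompletelyPositive (matMapL k φ) := by
  intro N X hX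
  obtain ⟨Y, rfl⟩ := hX
  have h1 : IsPosElem (Matrix.comp _ _ _ _ F (star Y * Y)) := by
    refine ⟨Matrix.comp _ _ _ _ F Y, ?_⟩
    ext ⟨a, b⟩ ⟨c, d⟩
    simp [Matrix.mul_apply, Matrix.star_apply, Matrix.sum_apply, Fintype.sum_prod_type]
  obtain ⟨Z, hZ⟩ := cp_fintype h h1
  refine ⟨(Matrix.comp _ _ _ _ D).symm Z, ?_⟩
  ext a c b d
  have := congrFun (congrFun hZ (a, b)) (c, d)
  simpa [Matrix.mul_apply, Matrix.star_apply, Matrix.sum_apply, Fintype.sum_prod_type, matMapL] using this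

theorem APd.mat {n : ℕ} {c : Fin (n + 1) → F} {c' : Fin (n + 1) → F'} {φ : F →ₗ[ℂ] D} {K : D → ℝ}
    {S : Finset D} {S' : Finset D'} {ε : ℝ} (hε : 0 ≤ ε)
    (eD : D' ≃⋆ₐ[ℂ] Matrix (Fin k) (Fin k) D) (eF : F' ≃⋆ₐ[ℂ] Matrix (Fin k) (Fin k) F)
    (hc : ∀ j, eF (c' j) = Matrix.diagonal fun _ => c j) (h : APd c φ K S ε)
    (hS : ∀ a ∈ S', ∀ i j, eD a i j ∈ S) :
    APd c' ((eD.symm : Matrix (Fin k) (Fin k) D →ₗ[ℂ] D') ∘ₗ matMapL k φ ∘ₗ (eF : F' →ₗ[ℂ] Matrix (Fin k) (Fin k) F))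
      (fun a => ∑ i, ∑ j, K (eD a i j)) S' ((k ^ 2 + k ^ 3 : ℝ) * ε) := by
  set Φ := ((eD.symm : Matrix (Fin k) (Fin k) D →ₗ[ℂ] D') ∘ₗ matMapL k φ ∘ₗ (eF : F' →ₗ[ℂ] Matrix (Fin k) (Fin k) F)) with hΦ
  have hΦe : ∀ x a b, eD (Φ x) a b = φ (eF x a b) := by
    intro x a b; simp [hΦ, matMapL]
  have hinj := EquivLike.injective eD
  refine ⟨cp_comp (cp_hom' _ (by simp) (by simp [map_star])) (cp_comp (cp_matMap h.cp) (cp_hom' _ (by simp) (by simp [map_star]))), 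
    ?_, ?_, ?_, ?_⟩
  · rw [le_iff_pos]
    obtain ⟨s, hs⟩ := (le_iff_pos _ _).mp h.le_one
    refine ⟨eD.symm (Matrix.diagonal fun _ => s), hinj ?_⟩
    ext a b
    rw [map_sub, Matrix.sub_apply, hΦe]
    simp [Matrix.star_eq_conjTranspose, Matrix.diagonal_conjTranspose, map_star]
    by_cases hab : a = b
    · subst hab; simp [hs]
    · simp [hab]
  · refine (mat_norm_le eD _).trans ?_
    have : ∀ a b, ‖eD (Φ 1 - 1) a b‖ ≤ ε := by
      intro a b
      rw [map_sub, Matrix.sub_apply, hΦe]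
      by_cases hab : a = b
      · subst hab; simpa using h.near
      · simpa [hab] using hε
    calc _ ≤ ∑ a : Fin k, ∑ b : Fin k, ε := Finset.sum_le_sum fun a _ => Finset.sum_le_sum fun b _ => this a b
      _ = (k ^ 2 : ℝ) * ε := by simp; ring
      _ ≤ _ := by gcongr; simp
  · intro j x y
    apply hinj
    ext a b
    have hcx : ∀ x p q, eF (c' j * x) p q = c j * eF x p q := by
      intro x p q; rw [map_mul, hc, Matrix.diagonal_mul]
    rw [map_mul eD, map_mul eD, Matrix.mul_apply, Matrix.mul_apply]
    simp only [hΦe, hcx]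
    rw [Finset.sum_eq_single (f := fun d => φ (eF (c' j) a d) * _) a]
    rotate_left
    · intro d _ hd
      have : eF (c' j) a d = 0 := by rw [hc, Matrix.diagonal_apply_ne' _ hd]
      rw [this]; simp
    · simp
    have : eF (c' j) a a = c j := by rw [hc, Matrix.diagonal_apply_eq]
    rw [this, map_mul eF, Matrix.mul_apply, Finset.mul_sum, map_sum, Finset.mul_sum]
    exact Finset.sum_congr rfl fun d _ => h.soz j _ _
  · intro a ha
    have hy : ∀ i j, ∃ y : F, ‖y‖ ≤ K (eD a i j) ∧ (∀ b, ‖φ (y * b) - eD a i j * φ b‖ ≤ ε * ‖b‖) ∧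
      (∀ b, ‖φ (star y * b) - star (eD a i j) * φ b‖ ≤ ε * ‖b‖) := fun i j => h.app _ (hS a ha i j)
    choose y hy1 hy2 hy3 using hy
    have aux : ∀ (z : F') (a : D'), (∀ i j b, ‖φ (eF z i j * b) - eD a i j * φ b‖ ≤ ε * ‖b‖) → 
        ∀ b, ‖Φ (z * b) - a * Φ b‖ ≤ (k ^ 2 + k ^ 3 : ℝ) * ε * ‖b‖ := by
      intro z a hz b
      refine (mat_norm_le eD _).trans ?_
      have : ∀ p q, ‖eD (Φ (z * b) - a * Φ b) p q‖ ≤ k * ε * ‖b‖ := by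
        intro p q
        rw [map_sub, Matrix.sub_apply, hΦe, map_mul, map_mul, Matrix.mul_apply, Matrix.mul_apply, map_sum, ← Finset.sum_sub_distrib]
        refine (norm_sum_le _ _).trans ?_
        calc _ ≤ ∑ i : Fin k, ε * ‖b‖ := by
              refine Finset.sum_le_sum fun i _ => ?_
              rw [hΦe]
              exact (hz p i _).trans (mul_le_mul_of_nonneg_left (mat_le_norm eF b i q) hε)
          _ = _ := by simp; ring
      calc _ ≤ ∑ a : Fin k, ∑ b' : Fin k, (k * ε * ‖b‖) := Finset.sum_le_sum fun a _ => Finset.sum_le_sum fun b _ => this a b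
        _ = (k ^ 3 : ℝ) * ε * ‖b‖ := by simp; ring
        _ ≤ _ := by gcongr; simp
    refine ⟨eF.symm (Matrix.of y), ?_, aux _ _ ?_, aux _ _ ?_⟩
    · refine (mat_norm_le eF _).trans ?_
      refine Finset.sum_le_sum fun i _ => Finset.sum_le_sum fun j _ => ?_
      simpa using hy1 i j
    · intro i j b; simpa using hy2 i j b
    · intro i j b; simpa [map_star, Matrix.star_apply] using hy3 j i b

def blkMat {I : Type} [Fintype I] [DecidableEq I] (m : I → Type) [∀ i, Fintype (m i)] [∀ i, DecidableEq (m i)] (k : ℕ) :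
    Blk (fun i => m i × Fin k) ≃⋆ₐ[ℂ] Matrix (Fin k) (Fin k) (Blk m) where
  toFun x := Matrix.of fun a b i => Matrix.of fun p q => x i (p, a) (q, b)
  invFun M := fun i => Matrix.of fun p q => M p.2 q.2 i p.1 q.1
  left_inv x := rfl
  right_inv x := rfl
  map_add' x y := rfl
  map_mul' x y := by
    ext a b i p q
    simp only [Matrix.mul_apply, Matrix.of_apply, Pi.mul_apply, Finset.sum_apply, Matrix.sum_apply, Fintype.sum_prod_type]
    rw [Finset.sum_comm]
  map_smul' t x := rfl
  map_star' x := rfl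

theorem ap_mat {n : ℕ} (eD : D' ≃⋆ₐ[ℂ] Matrix (Fin k) (Fin k) D) (h : APb n D) : APb n D' := by
  classical
  obtain ⟨K, h⟩ := h
  refine ⟨fun a => ∑ i, ∑ j, K (eD a i j), fun S ε hε => ?_⟩
  set δ := ε / (k ^ 2 + k ^ 3 + 1 : ℝ) with hδ
  have hδ0 : 0 < δ := by positivity
  obtain ⟨I, i1, i2, m, i3, i4, J, φ, hφ⟩ := h (S.biUnion fun a => Finset.univ.image fun p : Fin k × Fin k => eD a p.1 p.2) δ hδ0
  have := hφ.mat (c' := cproj J) (S' := S) hδ0.le eD (blkMat m k) ?_ ?_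
  · refine ⟨I, i1, i2, _, inferInstance, inferInstance, J, _, this.cp, this.le_one, this.near.trans ?_, this.soz, ?_⟩
    · rw [hδ, mul_div_assoc', div_le_iff₀ (by positivity)]; nlinarith
    · intro a ha
      obtain ⟨y, h1, h2, h3⟩ := this.app a ha
      have hle : ∀ b : ℝ, 0 ≤ b → (k ^ 2 + k ^ 3 : ℝ) * δ * b ≤ ε * b := by
        intro b hb
        apply mul_le_mul_of_nonneg_right _ hb
        rw [hδ, mul_div_assoc', div_le_iff₀ (by positivity)]; nlinarith
      exact ⟨y, h1, fun b => (h2 b).trans (hle _ (norm_nonneg _)), fun b => (h3 b).trans (hle _ (norm_nonneg _))⟩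
  · intro j
    ext a b i p q
    show (cproj J j : Blk (fun i => m i × Fin k)) i (p, a) (q, b) = _
    by_cases h : J i = j <;> by_cases hab : a = b <;> simp [cproj, h, hab, Matrix.one_apply]
  · intro a ha i j
    simp only [Finset.mem_biUnion, Finset.mem_image, Finset.mem_univ, true_and, Prod.exists]
    exact ⟨a, ha, i, j, rfl⟩
end Mat

section LemW
variable {D E F : Type*} [CStarAlgebra D] [CStarAlgebra E] [CStarAlgebra F]

theorem norm_mul_le_of_sq_le {x y : D} (z : D) {M : ℝ} (hM : 0 ≤ M)
    (h : star x * x ≤ (M ^ 2 : ℝ) • (star y * y)) : ‖x * z‖ ≤ M * ‖y * z‖ := by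
  have h1 := star_left_conjugate_le_conjugate h z
  have h2 : 0 ≤ star z * (star x * x) * z := star_left_conjugate_nonneg (star_mul_self_nonneg x) z
  have h3 := le_of_nonneg_norm h2 h1
  have e1 : star z * (star x * x) * z = star (x * z) * (x * z) := by rw [star_mul]; noncomm_ring
  have e2 : star z * ((M ^ 2 : ℝ) • (star y * y)) * z = (M ^ 2 : ℝ) • (star (y * z) * (y * z)) := by
    rw [star_mul]; simp [mul_assoc]
  rw [e1, e2, norm_smul, CStarRing.norm_star_mul_self, CStarRing.norm_star_mul_self, Real.norm_eq_abs,
    abs_of_nonneg (by positivity)] at h3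
  apply le_of_sq_le_sq _ (by positivity)
  nlinarith

theorem exists_res {r : D} (hr : 0 ≤ r) {e : ℝ} (he : 0 < e) :
    ∃ a : D, star a = a ∧ Commute a r ∧ ‖r * a‖ ≤ 1 ∧ ‖r * (1 - r * a)‖ ≤ e ∧ ‖1 - r * a‖ ≤ 1 := by
  have hs : ∀ x ∈ spectrum ℝ r, 0 ≤ x := fun x hx => spectrum_nonneg_of_nonneg hr hx
  have hsa : IsSelfAdjoint r := IsSelfAdjoint.of_nonneg hr
  have hc : ContinuousOn (fun t : ℝ => (t + e)⁻¹) (spectrum ℝ r) := by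
    refine ContinuousOn.inv₀ (by fun_prop) fun x hx => ?_
    have := hs x hx; positivity
  have h1 : r * cfc (fun t : ℝ => (t + e)⁻¹) r = cfc (fun t : ℝ => t * (t + e)⁻¹) r := by
    conv_lhs => enter [1]; rw [← cfc_id' ℝ r]
    rw [← cfc_mul ..]
  have h2 : 1 - r * cfc (fun t : ℝ => (t + e)⁻¹) r = cfc (fun t : ℝ => 1 - t * (t + e)⁻¹) r := by
    rw [h1, cfc_sub .., cfc_const_one ..]
  refine ⟨cfc (fun t : ℝ => (t + e)⁻¹) r, ?_, ?_, ?_, ?_, ?_⟩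
  · exact cfc_predicate (fun t : ℝ => (t + e)⁻¹) r
  · exact (Commute.refl r).cfc_real _
  · rw [h1]
    refine norm_cfc_le zero_le_one fun x hx => ?_
    have := hs x hx
    rw [Real.norm_eq_abs, abs_of_nonneg (by positivity), ← div_eq_mul_inv, div_le_one (by positivity)]
    linarith
  · rw [h2]
    conv_lhs => enter [1, 1]; rw [← cfc_id' ℝ r]
    rw [← cfc_mul ..]
    refine norm_cfc_le he.le fun x hx => ?_
    have := hs x hx
    have : x * (1 - x * (x + e)⁻¹) = e * (x / (x + e)) := by field_simp; ring
    rw [this, Real.norm_eq_abs, abs_of_nonneg (by positivity)]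
    have : x / (x + e) ≤ 1 := by rw [div_le_one (by positivity)]; linarith
    nlinarith
  · rw [h2]
    refine norm_cfc_le zero_le_one fun x hx => ?_
    have := hs x hx
    have : (1 - x * (x + e)⁻¹) = e / (x + e) := by field_simp; ring
    rw [this, Real.norm_eq_abs, abs_of_nonneg (by positivity), div_le_one (by positivity)]
    linarith

theorem lemW {g p : D} (hg : 0 ≤ g) (hg1 : ‖g‖ ≤ 1) (hp : p * p = p) (hps : star p = p) {c : ℝ} (hc0 : 0 ≤ c) (hc : c ≤ 3 / 4)
    (h : g * (1 - p) * g ≤ c • (g * g)) :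
    ∃ w : D, p * w = w ∧ star w * w = g * g ∧ ‖w - g‖ ≤ 2 * Real.sqrt c := by
  have hgs : star g = g := (IsSelfAdjoint.of_nonneg hg).star_eq
  have hgg : 0 ≤ g * g := by simpa [hgs] using star_mul_self_nonneg g
  have hX : 0 ≤ g * p * g := by
    have := star_mul_self_nonneg (p * g)
    rwa [star_mul, hps, hgs, mul_assoc, ← mul_assoc p, hp, ← mul_assoc] at this
  set r := CFC.sqrt (g * p * g) with hr
  have hr0 : 0 ≤ r := CFC.sqrt_nonneg _
  have hrs : star r = r := (IsSelfAdjoint.of_nonneg hr0).star_eq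
  have hrr : r * r = g * p * g := CFC.sqrt_mul_sqrt_self _
  -- bounds
  have b1 : (1 - c) • (g * g) ≤ r * r := by
    rw [← sub_nonneg] at h ⊢
    convert h using 1
    rw [hrr, sub_smul, one_smul]; noncomm_ring
  have b2 : r * r ≤ g * g := by
    have : 0 ≤ g * (1 - p) * g := by
      have := star_mul_self_nonneg ((1 - p) * g)
      have e : star ((1 - p) * g) * ((1 - p) * g) = g * (1 - p) * g := by
        rw [star_mul, star_sub, star_one, hps, hgs, mul_assoc, ← mul_assoc (1 - p)]
        have : (1 - p) * (1 - p) = 1 - p := by noncomm_ring; rw [hp]; abel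
        rw [this, mul_assoc]
      rwa [e] at this
    rw [← sub_nonneg]
    convert this using 1
    rw [hrr]; noncomm_ring
  have b3 : ‖g - r‖ ≤ c := by
    have s2 : r ≤ g := by
      have := CFC.sqrt_le_sqrt _ _ b2
      rwa [CFC.sqrt_mul_self r hr0, CFC.sqrt_mul_self g hg] at this
    have s1 : Real.sqrt (1 - c) • g ≤ r := by
      have := CFC.sqrt_le_sqrt _ _ b1
      rw [CFC.sqrt_mul_self r hr0] at this
      have e : CFC.sqrt ((1 - c) • (g * g)) = Real.sqrt (1 - c) • g := by
        apply CFC.sqrt_unique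
        · rw [smul_mul_smul_comm, Real.mul_self_sqrt (by linarith)]
        · exact smul_nonneg (Real.sqrt_nonneg _) hg
      rwa [e] at this
    have s3 : g - r ≤ (1 - Real.sqrt (1 - c)) • g := by
      rw [sub_smul, one_smul]; exact sub_le_sub_left s1 g
    have s4 := le_of_nonneg_norm (sub_nonneg.mpr s2) s3
    rw [norm_smul] at s4
    have s5 : 1 - c ≤ Real.sqrt (1 - c) := by
      apply Real.le_sqrt_of_sq_le; nlinarith
    have s6 : Real.sqrt (1 - c) ≤ 1 := by
      exact Real.sqrt_le_iff.mpr ⟨zero_le_one, by linarith⟩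
    rw [Real.norm_eq_abs, abs_of_nonneg (by linarith)] at s4
    refine s4.trans ?_
    nlinarith [norm_nonneg g]
  have b4 : ∀ z, ‖g * z‖ ≤ 2 * ‖r * z‖ := by
    intro z
    apply norm_mul_le_of_sq_le z (by norm_num)
    rw [hgs, hrs]
    have : (2 ^ 2 : ℝ) • ((1 - c) • (g * g)) ≤ (2 ^ 2 : ℝ) • (r * r) := smul_le_smul_of_nonneg_left b1 (by norm_num)
    refine le_trans ?_ this
    rw [smul_smul]
    have : (1 : ℝ) • (g * g) ≤ (2 ^ 2 * (1 - c)) • (g * g) := smul_le_smul_of_nonneg_right (by linarith) hgg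
    rwa [one_smul] at this
  have b5 : ∀ z, ‖p * g * z‖ = ‖r * z‖ := by
    intro z
    have : star (p * g * z) * (p * g * z) = star (r * z) * (r * z) := by
      simp only [star_mul, hps, hgs, hrs]
      have e1 : star z * (g * p) * (p * g * z) = star z * (g * (p * p) * g) * z := by noncomm_ring
      have e2 : star z * r * (r * z) = star z * (r * r) * z := by noncomm_ring
      rw [e1, e2, hrr, hp]
    have := congrArg norm this
    rw [CStarRing.norm_star_mul_self, CStarRing.norm_star_mul_self] at this
    nlinarith [norm_nonneg (p * g * z), norm_nonneg (r * z)]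
  -- sequence
  have hN : ∀ N : ℕ, (0 : ℝ) < 1 / (N + 1) := fun N => by positivity
  choose a has har ha1 ha2 ha3 using fun N : ℕ => exists_res hr0 (hN N)
  have har' : ∀ N, a N * r = r * a N := fun N => (har N).eq
  have c1 : ∀ N, ‖(1 - r * a N) * g‖ ≤ 2 * (1 / (N + 1)) := by
    intro N
    have : star ((1 - r * a N) * g) = g * (1 - r * a N) := by
      rw [star_mul, star_sub, star_mul, has, hrs, hgs, star_one, har']
    rw [← norm_star, this]
    exact (b4 _).trans (by linarith [ha2 N])
  set w : ℕ → D := fun N => p * g * a N * g with hw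
  have c2 : ∀ N M, ‖w N - w M‖ ≤ 2 * (1 / (N + 1)) + 2 * (1 / (M + 1)) := by
    intro N M
    have : w N - w M = p * g * ((a N - a M) * g) := by simp only [hw]; noncomm_ring
    rw [this, b5]
    have : r * ((a N - a M) * g) = (1 - r * a M) * g - (1 - r * a N) * g := by noncomm_ring
    rw [this]
    refine (norm_sub_le _ _).trans ?_
    linarith [c1 N, c1 M]
  have lim0 : Tendsto (fun N : ℕ => 2 * (1 / ((N : ℝ) + 1))) atTop (𝓝 0) := by
    simpa using tendsto_one_div_add_atTop_nhds_zero_nat.const_mul (2 : ℝ)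
  have hcau : CauchySeq w := by
    refine cauchySeq_of_le_tendsto_0 (fun N : ℕ => 2 * (1 / ((N : ℝ) + 1)) + 2 * (1 / ((N : ℝ) + 1))) ?_ (by simpa using lim0.add lim0)
    intro n m N hn hm
    rw [dist_eq_norm]
    refine (c2 n m).trans ?_
    gcongr
  obtain ⟨W, hW⟩ := cauchySeq_tendsto_of_complete hcau
  refine ⟨W, ?_, ?_, ?_⟩
  · have h1 : Tendsto (fun N => p * w N) atTop (𝓝 (p * W)) := hW.const_mul p
    have h2 : (fun N => p * w N) = w := by
      funext N; simp only [hw, ← mul_assoc, hp]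
    rw [h2] at h1
    exact tendsto_nhds_unique h1 hW
  · have h1 : Tendsto (fun N => star (w N) * w N) atTop (𝓝 (star W * W)) := hW.star.mul hW
    have h2 : ∀ N, star (w N) * w N = star (r * a N * g) * (r * a N * g) := by
      intro N
      simp only [hw, star_mul, hps, hgs, hrs, has]
      have e1 : g * (a N * (g * p)) * (p * g * a N * g) = g * a N * (g * (p * p) * g) * a N * g := by noncomm_ring
      have e2 : g * (a N * r) * (r * a N * g) = g * a N * (r * r) * a N * g := by noncomm_ring
      rw [e1, e2, hrr, hp]
    have h3 : Tendsto (fun N => r * a N * g) atTop (𝓝 g) := by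
      rw [tendsto_iff_norm_sub_tendsto_zero]
      refine squeeze_zero (fun _ => norm_nonneg _) (fun N => ?_) lim0
      have : r * a N * g - g = - ((1 - r * a N) * g) := by noncomm_ring
      rw [this, norm_neg]
      exact c1 N
    have h4 := h3.star.mul h3
    simp_rw [h2] at h1
    rw [tendsto_nhds_unique h1 h4, hgs]
  · have h1 : ∀ N, ‖w N - g‖ ≤ c + 1 / (N + 1) + Real.sqrt c := by
      intro N
      have e : w N - g = p * g * (a N * (g - r)) - p * g * (1 - r * a N) - (1 - p) * g := by
        have : p * g * (1 - r * a N) = p * g * (1 - a N * r) := by rw [har']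
        rw [this]; simp only [hw]; noncomm_ring
      have f1 : ‖p * g * (a N * (g - r))‖ ≤ c := by
        rw [b5, ← mul_assoc]
        refine (norm_mul_le _ _).trans ?_
        nlinarith [ha1 N, norm_nonneg (r * a N), norm_nonneg (g - r)]
      have f2 : ‖p * g * (1 - r * a N)‖ ≤ 1 / (N + 1) := by rw [b5]; exact ha2 N
      have f3 : ‖(1 - p) * g‖ ≤ Real.sqrt c := by
        apply Real.le_sqrt_of_sq_le
        rw [sq, ← CStarRing.norm_star_mul_self]
        have e : star ((1 - p) * g) * ((1 - p) * g) = g * (1 - p) * g := by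
          rw [star_mul, star_sub, star_one, hps, hgs, mul_assoc, ← mul_assoc (1 - p)]
          have : (1 - p) * (1 - p) = 1 - p := by noncomm_ring; rw [hp]; abel
          rw [this, mul_assoc]
        have f4 := star_mul_self_nonneg ((1 - p) * g)
        rw [e] at f4 ⊢
        refine (le_of_nonneg_norm f4 h).trans ?_
        rw [norm_smul, Real.norm_eq_abs, abs_of_nonneg hc0]
        have f5 := norm_mul_le g g
        have f6 : ‖g * g‖ ≤ 1 := f5.trans (by nlinarith [norm_nonneg g])
        exact mul_le_of_le_one_right hc0 f6
      rw [e]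
      refine (norm_sub_le _ _).trans ?_
      have := norm_sub_le (p * g * (a N * (g - r))) (p * g * (1 - r * a N))
      linarith
    have h2 : Tendsto (fun N => ‖w N - g‖) atTop (𝓝 ‖W - g‖) := (hW.sub_const g).norm
    have h3 : Tendsto (fun N : ℕ => c + 1 / ((N : ℝ) + 1) + Real.sqrt c) atTop (𝓝 (c + 0 + Real.sqrt c)) :=
      (tendsto_one_div_add_atTop_nhds_zero_nat.const_add c).add_const _
    have h4 := le_of_tendsto_of_tendsto' h2 h3 h1
    have h5 : c ≤ Real.sqrt c := by
      apply Real.le_sqrt_of_sq_le; nlinarith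
    linarith
end LemW

section LemC
variable {D E F : Type*} [CStarAlgebra D] [CStarAlgebra E] [CStarAlgebra F]

set_option maxHeartbeats 1000000 in
theorem lemC1 {ρ : F →ₗ[ℂ] D} (hρ : IsCompletelyPositive ρ) (h1 : ρ 1 ≤ 1)
    (hs : ∀ x y, ρ x * ρ y = ρ 1 * ρ (x * y)) {p : D} (hp : p * p = p) (hps : star p = p) {γ δ : ℝ} (hγ : 0 < γ)
    (hδ : 0 ≤ δ) (hδγ : δ / γ ≤ 3 / 4) (hd : ‖(1 - p) * ρ 1 * (1 - p)‖ ≤ δ) :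
    ∃ w : D, p * w = w ∧ ‖w‖ ≤ 1 ∧ (∀ x, star w * w * ρ x = ρ x * (star w * w)) ∧
      ∀ x, ‖w * ρ x * star w - ρ x‖ ≤ (4 * Real.sqrt (δ / γ) + Real.sqrt (2 * γ)) * ‖x‖ := by
  set h := ρ 1 with hh
  have h0 : 0 ≤ h := cp_nonneg hρ zero_le_one
  have hsa : IsSelfAdjoint h := IsSelfAdjoint.of_nonneg h0
  have hsp : ∀ x ∈ spectrum ℝ h, 0 ≤ x := fun x hx => spectrum_nonneg_of_nonneg h0 hx
  have hcomm : ∀ x, Commute h (ρ x) := by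
    intro x
    have := hs x 1
    rw [mul_one] at this
    exact this.symm
  set f : ℝ → ℝ := fun t => min 1 (max 0 (t / γ - 1)) with hf
  have hfc : Continuous f := by simp only [hf]; fun_prop
  set q : ℝ → ℝ := fun t => min 1 (t / γ) with hq
  have hqc : Continuous q := by simp only [hq]; fun_prop
  set g := cfc f h with hg
  set k := cfc q h with hk
  have hf0 : ∀ t, 0 ≤ f t := fun t => le_min zero_le_one (le_max_left _ _)
  have hf1 : ∀ t, f t ≤ 1 := fun t => min_le_left _ _
  have hg0 : 0 ≤ g := cfc_nonneg fun x _ => hf0 x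
  have hgs : star g = g := (IsSelfAdjoint.of_nonneg hg0).star_eq
  have hks : star k = k := (cfc_predicate q h : IsSelfAdjoint _)
  have hg1 : ‖g‖ ≤ 1 := norm_cfc_le zero_le_one fun x hx => by
    rw [Real.norm_eq_abs, abs_of_nonneg (hf0 x)]; exact hf1 x
  have hkg : k * g = g := by
    rw [hk, hg, ← cfc_mul q f h hqc.continuousOn hfc.continuousOn]
    congr 1
    funext t
    simp only [hq, hf]
    rcases le_total 1 (t / γ) with ht | ht
    · rw [min_eq_left ht, one_mul]
    · rw [max_eq_left (by linarith)]; simp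
  have hgk : g * k = g := by
    have := congrArg star hkg
    rwa [star_mul, hks, hgs] at this
  have hkk : k * k ≤ (1 / γ) • h := by
    have e : (1 / γ) • h = cfc (fun t : ℝ => (1 / γ) * t) h := by
      rw [cfc_const_mul .., cfc_id' ℝ h]
    rw [e, hk, ← cfc_mul q q h hqc.continuousOn hqc.continuousOn]
    apply cfc_mono
    · intro x hx
      have hx0 := hsp x hx
      simp only [hq]
      have : 0 ≤ x / γ := by positivity
      rw [one_div, inv_mul_eq_div]
      rcases le_total 1 (x / γ) with ht | ht
      · rw [min_eq_left ht]; linarith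
      · rw [min_eq_right ht]; nlinarith
    · exact (hqc.mul hqc).continuousOn
    · exact (continuous_const.mul continuous_id).continuousOn
  have hpp : star (1 - p) = 1 - p := by rw [star_sub, star_one, hps]
  have hpi : (1 - p) * (1 - p) = 1 - p := by noncomm_ring; rw [hp]; abel
  have hkp : ‖k * (1 - p)‖ ^ 2 ≤ δ / γ := by
    rw [sq, ← CStarRing.norm_star_mul_self]
    refine (le_of_nonneg_norm (star_mul_self_nonneg _) (b := (1 / γ) • ((1 - p) * h * (1 - p))) ?_).trans ?_
    · have := star_left_conjugate_le_conjugate hkk (1 - p)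
      rw [hpp] at this
      rw [star_mul, hks, hpp]
      convert this using 1
      · noncomm_ring
      · simp
    · rw [norm_smul, Real.norm_eq_abs, abs_of_nonneg (by positivity), one_div, inv_mul_eq_div]
      gcongr
  have hmain : g * (1 - p) * g ≤ (δ / γ) • (g * g) := by
    have a1 := star_mul_self_le ((1 - p) * k)
    have a2 : algebraMap ℝ D (‖(1 - p) * k‖ ^ 2) ≤ algebraMap ℝ D (δ / γ) := by
      apply algebraMap_mono
      rw [← norm_star, star_mul, hks, hpp]; exact hkp
    have a3 := star_left_conjugate_le_conjugate (a1.trans a2) g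
    rw [hgs] at a3
    convert a3 using 1
    · rw [star_mul, hks, hpp]
      have : g * (k * (1 - p) * ((1 - p) * k)) * g = (g * k) * ((1 - p) * (1 - p)) * (k * g) := by noncomm_ring
      rw [this, hgk, hkg, hpi]
    · rw [Algebra.algebraMap_eq_smul_one]; simp
  obtain ⟨w, hw1, hw2, hw3⟩ := lemW hg0 hg1 hp hps (by positivity) hδγ hmain
  have hgc : ∀ x, Commute g (ρ x) := fun x => (hcomm x).cfc_real f
  have hwn : ‖w‖ ≤ 1 := by
    have := congrArg norm hw2
    rw [CStarRing.norm_star_mul_self] at this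
    have := norm_mul_le g g
    nlinarith [norm_nonneg w, norm_nonneg g]
  refine ⟨w, hw1, hwn, ?_, ?_⟩
  · intro x
    rw [hw2]
    exact ((hgc x).mul_left (hgc x)).eq
  · intro x
    set μ := Real.sqrt (δ / γ) with hμ
    have hμ0 : 0 ≤ μ := Real.sqrt_nonneg _
    have hρx : ‖ρ x‖ ≤ ‖x‖ := cp_contr hρ h1 x
    have t1 : ‖w * ρ x * star w - g * ρ x * g‖ ≤ 4 * μ * ‖x‖ := by
      have e : w * ρ x * star w - g * ρ x * g = (w - g) * ρ x * star w + g * ρ x * star (w - g) := by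
        rw [star_sub, hgs]; noncomm_ring
      rw [e]
      refine (norm_add_le _ _).trans ?_
      have u1 : ‖(w - g) * ρ x * star w‖ ≤ (2 * μ) * ‖x‖ * 1 := by
        refine (norm_mul_le _ _).trans ?_
        rw [norm_star]
        gcongr
        refine (norm_mul_le _ _).trans ?_
        gcongr
      have u2 : ‖g * ρ x * star (w - g)‖ ≤ 1 * ‖x‖ * (2 * μ) := by
        refine (norm_mul_le _ _).trans ?_
        rw [norm_star]
        gcongr
        refine (norm_mul_le _ _).trans ?_
        gcongr
      linarith
    have t2 : ‖g * ρ x * g - ρ x‖ ≤ Real.sqrt (2 * γ) * ‖x‖ := by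
      set z := cfc (fun t => 1 - f t * f t) h with hz
      have hzc : Continuous fun t => 1 - f t * f t := continuous_const.sub (hfc.mul hfc)
      have hzs : star z = z := (cfc_predicate (fun t => 1 - f t * f t) h : IsSelfAdjoint _)
      have hzg : z = 1 - g * g := by
        rw [hz, hg, cfc_sub (fun _ => (1:ℝ)) (fun t => f t * f t) h continuousOn_const (hfc.mul hfc).continuousOn, cfc_const_one ℝ h, cfc_mul f f h hfc.continuousOn hfc.continuousOn]
      have e : g * ρ x * g - ρ x = - (z * ρ x) := by
        rw [hzg, mul_assoc, ← (hgc x).eq]; noncomm_ring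
      rw [e, norm_neg]
      have hzz : ‖z * h * z‖ ≤ 2 * γ := by
        have : z * h * z = cfc (fun t => (1 - f t * f t) * t * (1 - f t * f t)) h := by
          rw [cfc_mul (fun t => (1 - f t * f t) * t) (fun t => 1 - f t * f t) h (hzc.mul continuous_id).continuousOn hzc.continuousOn,
            cfc_mul (fun t => 1 - f t * f t) (fun t => t) h hzc.continuousOn continuous_id.continuousOn, cfc_id' ℝ h]
        rw [this]
        refine norm_cfc_le (by positivity) fun t ht => ?_
        have ht0 := hsp t ht
        have hff : 0 ≤ f t * f t ∧ f t * f t ≤ 1 := ⟨by nlinarith [hf0 t], by nlinarith [hf0 t, hf1 t]⟩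
        rw [Real.norm_eq_abs, abs_of_nonneg (by
          have : 0 ≤ 1 - f t * f t := by linarith
          positivity)]
        rcases le_total (2 * γ) t with h2 | h2
        · have : f t = 1 := by
            simp only [hf]
            have : 2 ≤ t / γ := by rw [le_div_iff₀ hγ]; exact h2
            rw [max_eq_right (by linarith), min_eq_left (by linarith)]
          rw [this]; simp; positivity
        · have v : (1 - f t * f t) * t ≤ t := by nlinarith
          have v0 : 0 ≤ (1 - f t * f t) * t := mul_nonneg (by linarith) ht0
          nlinarith
      have b1 : z * (ρ x * star (ρ x)) * z ≤ (‖x‖ ^ 2) • (z * h * z) := by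
        have c1 : ρ x * star (ρ x) ≤ (‖x‖ ^ 2) • h := by
          refine (cp_schwarz' hρ h1 x).trans ?_
          have c2 := star_mul_self_le (star x)
          rw [star_star, norm_star] at c2
          refine (cp_mono hρ c2).trans (le_of_eq ?_)
          rw [Algebra.algebraMap_eq_smul_one, hh, ← Complex.coe_smul, ← Complex.coe_smul, map_smul]
        have c3 := star_left_conjugate_le_conjugate c1 z
        rw [hzs] at c3
        convert c3 using 1
        simp
      have b2 : 0 ≤ z * (ρ x * star (ρ x)) * z := by
        have := mul_star_self_nonneg (z * ρ x)
        rw [star_mul, hzs] at this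
        convert this using 1
        noncomm_ring
      have b3 := le_of_nonneg_norm b2 b1
      have e2 : z * (ρ x * star (ρ x)) * z = (z * ρ x) * star (z * ρ x) := by
        rw [star_mul, hzs]; noncomm_ring
      rw [e2, CStarRing.norm_self_mul_star, norm_smul, Real.norm_eq_abs, abs_of_nonneg (by positivity)] at b3
      apply le_of_sq_le_sq _ (by positivity)
      rw [mul_pow, Real.sq_sqrt (by positivity)]
      nlinarith [sq_nonneg ‖x‖]
    have e : w * ρ x * star w - ρ x = (w * ρ x * star w - g * ρ x * g) + (g * ρ x * g - ρ x) := by abel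
    rw [e]
    refine (norm_add_le _ _).trans ?_
    linarith

theorem proj_norm_le {p : D} (hp : p * p = p) (hps : star p = p) : ‖p‖ ≤ 1 := by
  have := CStarRing.norm_star_mul_self (x := p)
  rw [hps, hp] at this
  by_contra hc
  push Not at hc
  nlinarith

theorem proj_le_one {p : D} (hp : p * p = p) (hps : star p = p) : p ≤ 1 := by
  have : 0 ≤ star (1 - p) * (1 - p) := star_mul_self_nonneg _
  rw [star_sub, star_one, hps] at this
  have e : (1 - p) * (1 - p) = 1 - p := by noncomm_ring; rw [hp]; abel
  rw [e] at this
  exact sub_nonneg.mp this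

theorem lemC {n : ℕ} {c : Fin (n + 1) → F} (hcc : ∀ j x, c j * x = x * c j) (hci : ∀ j, c j * c j = c j)
    (hco : ∀ i j, i ≠ j → c i * c j = 0) (hcs : ∀ j, star (c j) = c j) (hsum : ∑ j, c j = 1)
    {φ : F →ₗ[ℂ] D} (hφ : IsCompletelyPositive φ) (h1 : φ 1 ≤ 1)
    (hs : ∀ j x y, φ (c j * x) * φ (c j * y) = φ (c j) * φ (c j * (x * y)))
    {p : D} (hp : p * p = p) (hps : star p = p) {γ δ : ℝ} (hγ : 0 < γ)
    (hδ : 0 ≤ δ) (hδγ : δ / γ ≤ 3 / 4) (hd : ‖φ 1 - p‖ ≤ δ) :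
    ∃ φ' : F →ₗ[ℂ] D, IsCompletelyPositive φ' ∧ φ' 1 ≤ 1 ∧ (∀ x, p * φ' x * p = φ' x) ∧
      (∀ j x y, φ' (c j * x) * φ' (c j * y) = φ' (c j) * φ' (c j * (x * y))) ∧
      ∀ x, ‖φ' x - φ x‖ ≤ 2 * (n + 1) * (4 * Real.sqrt (δ / γ) + Real.sqrt (2 * γ)) * ‖x‖ := by
  set τ := 4 * Real.sqrt (δ / γ) + Real.sqrt (2 * γ) with hτ
  have hτ0 : 0 ≤ τ := by positivity
  have hpp : star (1 - p) = 1 - p := by rw [star_sub, star_one, hps]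
  have hpi : (1 - p) * (1 - p) = 1 - p := by noncomm_ring; rw [hp]; abel
  let ρ : Fin (n + 1) → F →ₗ[ℂ] D := fun j => φ ∘ₗ LinearMap.mulLeft ℂ (c j)
  have hρa : ∀ j x, ρ j x = φ (c j * x) := fun j x => rfl
  have hρcp : ∀ j, IsCompletelyPositive (ρ j) := by
    intro j
    apply cp_comp hφ
    refine cp_conj (c j) LinearMap.id (cp_hom' _ (fun _ _ => rfl) (fun _ => rfl)) _ ?_
    intro x
    simp only [LinearMap.mulLeft_apply, LinearMap.id_apply, hcs]
    rw [mul_assoc, ← hcc, ← mul_assoc, hci]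
  have hc1 : ∀ j, φ (c j) ≤ φ 1 := fun j => cp_mono hφ (proj_le_one (hci j) (hcs j))
  have hρ1 : ∀ j, ρ j 1 = φ (c j) := fun j => by rw [hρa, mul_one]
  have hρs : ∀ j x y, ρ j x * ρ j y = ρ j 1 * ρ j (x * y) := by
    intro j x y; rw [hρ1]; exact hs j x y
  have hρd : ∀ j, ‖(1 - p) * ρ j 1 * (1 - p)‖ ≤ δ := by
    intro j
    rw [hρ1]
    have a1 := star_left_conjugate_le_conjugate (hc1 j) (1 - p)
    have a0 := star_left_conjugate_nonneg (hρ1 j ▸ cp_nonneg (hρcp j) zero_le_one) (1 - p)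
    rw [hpp] at a1 a0
    refine (le_of_nonneg_norm a0 a1).trans ?_
    have : (1 - p) * φ 1 * (1 - p) = (1 - p) * (φ 1 - p) * (1 - p) := by
      have : (1 - p) * p = 0 := by rw [sub_mul, hp, one_mul, sub_self]
      rw [mul_sub (1 - p) (φ 1) p, this, sub_zero]
    rw [this]
    have n1 := proj_norm_le hpi hpp
    calc _ ≤ ‖1 - p‖ * ‖φ 1 - p‖ * ‖1 - p‖ := norm_mul₃_le
      _ ≤ 1 * δ * 1 := by gcongr
      _ = δ := by ring
  choose w hw1 hw2 hw3 hw4 using fun j => lemC1 (hρcp j) ((hρ1 j).le.trans ((hc1 j).trans h1)) (hρs j) hp hps hγ hδ hδγ (hρd j)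
  have hw1' : ∀ j, star (w j) * p = star (w j) := fun j => by
    have := congrArg star (hw1 j); rwa [star_mul, hps] at this
  let σ : Fin (n + 1) → F →ₗ[ℂ] D := fun j =>
    LinearMap.mulRight ℂ (star (w j)) ∘ₗ LinearMap.mulLeft ℂ (w j) ∘ₗ ρ j
  have hσa : ∀ j x, σ j x = w j * ρ j x * star (w j) := fun j x => rfl
  have hσcp : ∀ j, IsCompletelyPositive (σ j) := fun j => cp_conj (w j) (ρ j) (hρcp j) _ (hσa j)
  let φ₁ : F →ₗ[ℂ] D := ∑ j, σ j
  have hφ₁ : ∀ x, φ₁ x = ∑ j, σ j x := fun x => by simp [φ₁]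
  have hcp₁ : IsCompletelyPositive φ₁ := cp_sum _ fun j _ => hσcp j
  have hd₁ : ∀ x, ‖φ₁ x - φ x‖ ≤ (n + 1) * τ * ‖x‖ := by
    intro x
    have : φ x = ∑ j, ρ j x := by
      simp only [hρa]; rw [← map_sum, ← Finset.sum_mul, hsum, one_mul]
    rw [this, hφ₁, ← Finset.sum_sub_distrib]
    refine (norm_sum_le _ _).trans ?_
    refine (Finset.sum_le_sum fun j _ => hw4 j x).trans ?_
    rw [Finset.sum_const, Finset.card_univ, Fintype.card_fin, nsmul_eq_mul]; push_cast; exact le_of_eq (by rw [hτ]; ring)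
  have hφ1n : ‖φ 1‖ ≤ 1 := (cp_contr hφ h1 1).trans norm_one_le'
  set T : ℝ := (n + 1) * τ with hT
  have hT0 : 0 ≤ T := by positivity
  set s : ℝ := 1 / (1 + T) with hs'
  have hs0 : 0 < s := by positivity
  have hsT : s * (1 + T) = 1 := by rw [hs']; field_simp
  have hcp₂ := cp_smul hcp₁ s hs0.le
  have hns : ‖(s : ℂ)‖ = s := by rw [Complex.norm_real, Real.norm_eq_abs, abs_of_pos hs0]
  refine ⟨(s : ℂ) • φ₁, hcp₂, ?_, ?_, ?_, ?_⟩
  · rw [← CStarAlgebra.norm_le_one_iff_of_nonneg _ (cp_nonneg hcp₂ zero_le_one)]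
    rw [LinearMap.smul_apply, norm_smul, hns]
    have : ‖φ₁ 1‖ ≤ 1 + T := by
      have e : φ₁ 1 = (φ₁ 1 - φ 1) + φ 1 := by abel
      rw [e]
      refine (norm_add_le _ _).trans ?_
      have := hd₁ 1
      have n1 : ‖(1 : F)‖ ≤ 1 := norm_one_le'
      have : (n + 1) * τ * ‖(1 : F)‖ ≤ T := mul_le_of_le_one_right hT0 n1
      linarith
    calc s * ‖φ₁ 1‖ ≤ s * (1 + T) := by gcongr
      _ = 1 := hsT
  · intro x
    rw [LinearMap.smul_apply, hφ₁, mul_smul_comm, smul_mul_assoc, Finset.mul_sum, Finset.sum_mul]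
    congr 1
    refine Finset.sum_congr rfl fun j _ => ?_
    rw [hσa, ← mul_assoc, ← mul_assoc, hw1, mul_assoc _ _ p, hw1']
  · have key : ∀ j x, φ₁ (c j * x) = σ j x := by
      intro j x
      rw [hφ₁, Finset.sum_eq_single j]
      · rw [hσa, hσa, hρa, hρa, ← mul_assoc, hci]
      · intro i _ hi
        rw [hσa, hρa, ← mul_assoc, hco _ _ hi, zero_mul, map_zero, mul_zero, zero_mul]
      · simp
    intro j x y
    have k1 : φ₁ (c j) = σ j 1 := by rw [← key, mul_one]
    simp only [LinearMap.smul_apply, key, k1, smul_mul_smul_comm]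
    congr 1
    simp only [hσa]
    have e1 : w j * ρ j x * star (w j) * (w j * ρ j y * star (w j)) = w j * (ρ j x * (star (w j) * w j)) * ρ j y * star (w j) := by
      noncomm_ring
    have e2 : w j * ρ j 1 * star (w j) * (w j * ρ j (x * y) * star (w j)) = w j * (ρ j 1 * (star (w j) * w j)) * ρ j (x * y) * star (w j) := by
      noncomm_ring
    rw [e1, e2, ← hw3, ← hw3]
    simp only [mul_assoc]
    rw [← mul_assoc (ρ j x), hρs j x y]
    simp only [mul_assoc]
  · intro x
    have e : ((s : ℂ) • φ₁) x - φ x = (s : ℂ) • (φ₁ x - φ x) - ((1 - s : ℝ) : ℂ) • φ x := by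
      rw [LinearMap.smul_apply, smul_sub]; push_cast; rw [sub_smul, one_smul]; abel
    rw [e]
    refine (norm_sub_le _ _).trans ?_
    have hs1 : 0 ≤ 1 - s := by nlinarith
    rw [norm_smul, norm_smul, hns, Complex.norm_real, Real.norm_eq_abs, abs_of_nonneg hs1]
    have b1 := hd₁ x
    have b2 := cp_contr hφ h1 x
    have b3 : s ≤ 1 := by linarith
    have b4 : 1 - s ≤ T := by nlinarith
    calc s * ‖φ₁ x - φ x‖ + (1 - s) * ‖φ x‖ ≤ 1 * (T * ‖x‖) + T * ‖x‖ := by gcongr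
      _ = _ := by rw [hT]; ring

theorem exists_gd (n : ℕ) {η : ℝ} (hη : 0 < η) : ∃ γ δ : ℝ, 0 < γ ∧ 0 < δ ∧ δ / γ ≤ 3 / 4 ∧
    2 * ((n : ℝ) + 1) * (4 * Real.sqrt (δ / γ) + Real.sqrt (2 * γ)) ≤ η := by
  set u : ℝ := min (1/2) (η / (10 * (n + 1))) with hu
  have hu0 : 0 < u := by positivity
  have hu1 : u ≤ 1/2 := min_le_left _ _
  have hu2 : u ≤ η / (10 * (n + 1)) := min_le_right _ _
  refine ⟨u ^ 2 / 2, u ^ 2 * (u ^ 2 / 2), by positivity, by positivity, ?_, ?_⟩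
  · rw [mul_div_cancel_right₀ _ (by positivity)]; nlinarith
  · rw [mul_div_cancel_right₀ _ (by positivity), mul_div_cancel₀ _ (by norm_num), Real.sqrt_sq hu0.le]
    rw [le_div_iff₀ (by positivity)] at hu2
    nlinarith
end LemC

section Cut

theorem mat_cut {m : Type} [Fintype m] [DecidableEq m] (t : Matrix m m ℂ) (ht : t.IsHermitian) :
    ∃ (m' : Type) (_ : Fintype m') (_ : DecidableEq m') (V : Matrix m m' ℂ) (f : Matrix m m ℂ), V.conjTranspose * V = 1 ∧
      t - V * V.conjTranspose = t * ((1 - t) * f) ∧ ‖f‖ ≤ 2 ∧ ‖(1 - t) * f‖ ≤ 1 := by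
  classical
  set U : Matrix m m ℂ := (ht.eigenvectorUnitary : Matrix m m ℂ) with hU
  have hUU : U.conjTranspose * U = 1 := (Matrix.mem_unitaryGroup_iff'.mp ht.eigenvectorUnitary.2)
  have hUU' : U * U.conjTranspose = 1 := (Matrix.mem_unitaryGroup_iff.mp ht.eigenvectorUnitary.2)
  set l := ht.eigenvalues with hl
  let E : (m → ℂ) → Matrix m m ℂ := fun d => U * Matrix.diagonal d * U.conjTranspose
  have hE : ∀ d, E d = U * Matrix.diagonal d * U.conjTranspose := fun d => rfl
  have htE : t = E (fun k => (l k : ℂ)) := by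
    have := ht.spectral_theorem
    rw [Unitary.conjStarAlgAut_apply] at this
    exact this
  have hEm : ∀ d e, E d * E e = E (fun k => d k * e k) := by
    intro d e
    rw [hE, hE, hE, ← Matrix.diagonal_mul_diagonal]
    calc _ = U * Matrix.diagonal d * (U.conjTranspose * U) * Matrix.diagonal e * U.conjTranspose := by simp only [mul_assoc]
      _ = _ := by rw [hUU, mul_one, mul_assoc U]
  have hEs : ∀ d e, E d - E e = E (fun k => d k - e k) := by
    intro d e
    rw [hE, hE, hE, ← sub_mul, ← mul_sub, Matrix.diagonal_sub]
  have hE1 : E (fun _ => 1) = 1 := by rw [hE, Matrix.diagonal_one, mul_one, hUU']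
  have hUn : ‖U‖ ≤ 1 := by
    have h1 := Matrix.l2_opNorm_conjTranspose_mul_self U
    rw [hUU] at h1
    have h2 : ‖(1 : Matrix m m ℂ)‖ ≤ 1 := norm_one_le'
    nlinarith [norm_nonneg U]
  have hEn : ∀ d (r : ℝ), 0 ≤ r → (∀ k, ‖d k‖ ≤ r) → ‖E d‖ ≤ r := by
    intro d r hr hd
    have h1 : ‖Matrix.diagonal d‖ ≤ r := by
      rw [Matrix.l2_opNorm_diagonal]; exact (pi_norm_le_iff_of_nonneg hr).mpr hd
    have h2 : ‖U.conjTranspose‖ ≤ 1 := by rwa [Matrix.l2_opNorm_conjTranspose]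
    calc _ ≤ ‖U‖ * ‖Matrix.diagonal d‖ * ‖U.conjTranspose‖ := norm_mul₃_le
      _ ≤ 1 * r * 1 := by gcongr
      _ = r := by ring
  let f : m → ℝ := fun k => if 1 / 2 < l k then - (1 / l k) else 1 / (1 - l k)
  refine ⟨{k // 1 / 2 < l k}, inferInstance, inferInstance, U.submatrix id Subtype.val, E (fun k => (f k : ℂ)), ?_, ?_, ?_, ?_⟩
  · ext i j
    have := congrFun (congrFun hUU i.1) j.1
    rw [Matrix.mul_apply] at this ⊢
    simp only [Matrix.conjTranspose_apply, Matrix.submatrix_apply, id] at this ⊢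
    rw [this, Matrix.one_apply, Matrix.one_apply]
    simp [Subtype.ext_iff]
  · have hV : U.submatrix id (Subtype.val : {k // 1 / 2 < l k} → m) * (U.submatrix id (Subtype.val : {k // 1 / 2 < l k} → m)).conjTranspose =
        E (fun k => if 1 / 2 < l k then 1 else 0) := by
      ext i j
      rw [hE, Matrix.mul_apply, Matrix.mul_apply]
      simp only [Matrix.mul_diagonal, Matrix.conjTranspose_apply, Matrix.submatrix_apply, id, mul_ite, mul_one, mul_zero, ite_mul, zero_mul]
      rw [← Finset.sum_filter, Finset.sum_subtype (p := fun k => 1 / 2 < l k) (Finset.univ.filter fun k => 1 / 2 < l k) (by simp)]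
    rw [hV, htE, ← hE1, hEs, hEs, hEm, hEm]
    congr 1
    funext k
    simp only [f]
    split_ifs with h
    · have : (l k : ℂ) ≠ 0 := by exact_mod_cast (show l k ≠ 0 by linarith)
      push_cast
      field_simp
      ring
    · have : (1 - l k : ℂ) ≠ 0 := by exact_mod_cast (show 1 - l k ≠ 0 by linarith)
      push_cast
      field_simp
      ring
  · refine hEn _ _ (by norm_num) fun k => ?_
    rw [Complex.norm_real, Real.norm_eq_abs]
    simp only [f]
    split_ifs with h
    · rw [abs_neg, abs_of_nonneg (by positivity), div_le_iff₀ (by linarith)]; linarith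
    · rw [abs_of_nonneg (one_div_nonneg.mpr (by linarith)), div_le_iff₀ (by linarith)]; linarith
  · rw [htE, ← hE1, hEs, hEm]
    refine hEn _ _ (by norm_num) fun k => ?_
    rw [← Complex.ofReal_one, ← Complex.ofReal_sub, ← Complex.ofReal_mul, Complex.norm_real, Real.norm_eq_abs]
    simp only [f]
    split_ifs with h
    · have hp : 0 < l k := by linarith
      have : (1 - l k) * -(1 / l k) = (l k - 1) / l k := by field_simp; ring
      rw [this, abs_le, le_div_iff₀ hp, div_le_iff₀ hp]
      constructor <;> linarith
    · rw [mul_one_div_cancel (by linarith)]; simp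

theorem blk_cut {I : Type} [Fintype I] [DecidableEq I] {m : I → Type} [∀ i, Fintype (m i)] [∀ i, DecidableEq (m i)]
    {n : ℕ} (J : I → Fin (n + 1)) (t : Blk m) (ht : star t = t) :
    ∃ (m' : I → Type) (_ : ∀ i, Fintype (m' i)) (_ : ∀ i, DecidableEq (m' i)) (Θ : Blk m' →ₗ[ℂ] Blk m) (Ψ : Blk m → Blk m') (f : Blk m),
      (∀ x y, Θ (x * y) = Θ x * Θ y) ∧ (∀ x, Θ (star x) = star (Θ x)) ∧ (∀ x, ‖Θ x‖ ≤ ‖x‖) ∧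
      (∀ y, ‖Ψ y‖ ≤ ‖y‖) ∧ (∀ y, Ψ (star y) = star (Ψ y)) ∧ (∀ y, Θ (Ψ y) = Θ 1 * y * Θ 1) ∧
      (∀ j, Θ (cproj J j) = cproj J j * Θ 1) ∧ t - Θ 1 = t * ((1 - t) * f) ∧ ‖f‖ ≤ 2 ∧ ‖(1 - t) * f‖ ≤ 1 := by
  have hti : ∀ i, (t i).IsHermitian := fun i => congrFun ht i
  choose m' i1 i2 V f hV hf hn1 hn2 using fun i => mat_cut (t i) (hti i)
  have hVn : ∀ i, ‖V i‖ ≤ 1 := by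
    intro i
    have h1 := Matrix.l2_opNorm_conjTranspose_mul_self (V i)
    rw [hV] at h1
    have h2 : ‖(1 : Matrix (m' i) (m' i) ℂ)‖ ≤ 1 := norm_one_le'
    nlinarith [norm_nonneg (V i)]
  have hVn' : ∀ i, ‖(V i).conjTranspose‖ ≤ 1 := fun i => by rw [Matrix.l2_opNorm_conjTranspose]; exact hVn i
  refine ⟨m', i1, i2, 
    { toFun := fun x i => V i * x i * (V i).conjTranspose
      map_add' := fun x y => by funext i; simp [Matrix.mul_add, Matrix.add_mul]
      map_smul' := fun c x => by funext i; simp }, fun y i => (V i).conjTranspose * y i * V i, f, ?_, ?_, ?_, ?_, ?_, ?_, ?_, ?_, ?_, ?_⟩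
  · intro x y; funext i
    simp only [LinearMap.coe_mk, AddHom.coe_mk, Pi.mul_apply]
    have e : V i * x i * (V i).conjTranspose * (V i * y i * (V i).conjTranspose) =
        V i * x i * ((V i).conjTranspose * V i) * y i * (V i).conjTranspose := by simp only [Matrix.mul_assoc]
    rw [e, hV, Matrix.mul_one, Matrix.mul_assoc (V i) (x i)]
  · intro x; funext i
    simp [Matrix.star_eq_conjTranspose, Matrix.mul_assoc]
  · intro x
    refine (pi_norm_le_iff_of_nonneg (norm_nonneg _)).mpr fun i => ?_
    simp only [LinearMap.coe_mk, AddHom.coe_mk]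
    have := norm_le_pi_norm x i
    calc _ ≤ ‖V i * x i‖ * ‖(V i).conjTranspose‖ := Matrix.l2_opNorm_mul _ _
      _ ≤ (‖V i‖ * ‖x i‖) * ‖(V i).conjTranspose‖ := by gcongr; exact Matrix.l2_opNorm_mul _ _
      _ ≤ (1 * ‖x‖) * 1 := by gcongr <;> first | exact hVn i | exact hVn' i
      _ = _ := by ring
  · intro x
    refine (pi_norm_le_iff_of_nonneg (norm_nonneg _)).mpr fun i => ?_
    have := norm_le_pi_norm x i
    calc _ ≤ ‖(V i).conjTranspose * x i‖ * ‖V i‖ := Matrix.l2_opNorm_mul _ _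
      _ ≤ (‖(V i).conjTranspose‖ * ‖x i‖) * ‖V i‖ := by gcongr; exact Matrix.l2_opNorm_mul _ _
      _ ≤ (1 * ‖x‖) * 1 := by gcongr <;> first | exact hVn i | exact hVn' i
      _ = _ := by ring
  · intro x; funext i
    simp [Matrix.star_eq_conjTranspose, Matrix.mul_assoc]
  · intro x; funext i
    simp [Matrix.mul_assoc]
  · intro j; funext i
    by_cases h : J i = j <;> simp [cproj, h]
  · funext i
    have := hf i
    simpa using this
  · exact (pi_norm_le_iff_of_nonneg (by norm_num)).mpr hn1
  · exact (pi_norm_le_iff_of_nonneg (by norm_num)).mpr hn2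
end Cut

section Corner
variable {D D' F F' : Type*} [CStarAlgebra D] [CStarAlgebra D'] [CStarAlgebra F] [CStarAlgebra F']

theorem sqrt_corner {W Q : D} (hW0 : 0 ≤ W) (hWQ : W * Q = W) (hQs : star Q = Q) :
    ∃ Z, star Z = Z ∧ Z * Z = W ∧ Z * Q = Z ∧ Q * Z = Z := by
  set Z := CFC.sqrt W with hZ
  have hZZ : Z * Z = W := CFC.sqrt_mul_sqrt_self _
  have hZs : star Z = Z := (IsSelfAdjoint.of_nonneg (CFC.sqrt_nonneg _)).star_eq
  have hz : Z * (1 - Q) = 0 := by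
    rw [← CStarRing.star_mul_self_eq_zero_iff, star_mul, hZs, mul_assoc, ← mul_assoc Z, hZZ, mul_sub W, hWQ]
    simp
  have hz1 : Z * Q = Z := by
    rw [mul_sub, mul_one, sub_eq_zero] at hz; exact hz.symm
  refine ⟨Z, hZs, hZZ, hz1, ?_⟩
  have := congrArg star hz1
  rwa [star_mul, hZs, hQs] at this

theorem corner_pos {p : D} (ι : D' →⋆ₙₐ[ℂ] D) (hinj : Function.Injective ι) (h1 : ι 1 = p)
    (hr : Set.range ι = {x | p * x * p = x}) {k : ℕ} {X : Matrix (Fin k) (Fin k) D'} (h : IsPosElem (X.map ι)) : IsPosElem X := by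
  let e : Matrix (Fin k) (Fin k) D ≃⋆ₐ[ℂ] CStarMatrix (Fin k) (Fin k) D := CStarMatrix.ofMatrixStarAlgEquiv
  have hps : star p = p := by rw [← h1, ← map_star, star_one]
  have hιp : ∀ x, ι x * p = ι x := fun x => by rw [← h1, ← map_mul, mul_one]
  have hW0 : 0 ≤ e (X.map ι) := by
    obtain ⟨y, hy⟩ := h
    rw [hy, map_mul, map_star]; exact star_mul_self_nonneg _
  set Q := Matrix.diagonal (fun _ : Fin k => p) with hQ
  have hXQ : X.map ι * Q = X.map ι := by
    ext i j; rw [hQ, Matrix.mul_diagonal, Matrix.map_apply, hιp]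
  have hQs : star Q = Q := by
    rw [hQ, Matrix.star_eq_conjTranspose, Matrix.diagonal_conjTranspose]; congr 1; funext i; exact hps
  obtain ⟨Z, hZs, hZZ, hz1, hz2⟩ := sqrt_corner hW0 (Q := e Q) (by rw [← map_mul, hXQ]) (by rw [← map_star, hQs])
  set Y := e.symm Z with hY
  have hYs : star Y = Y := by rw [hY, ← map_star, hZs]
  have hYY : Y * Y = X.map ι := by rw [hY, ← map_mul, hZZ]; simp
  have hy1 : Y * Q = Y := by
    have := congrArg e.symm hz1
    rw [map_mul] at this; simpa [hY] using this
  have hy2 : Q * Y = Y := by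
    have := congrArg e.symm hz2
    rw [map_mul] at this; simpa [hY] using this
  have : ∀ i j, ∃ z, ι z = Y i j := by
    intro i j
    have a1 := congrFun (congrFun hy1 i) j
    have a2 := congrFun (congrFun hy2 i) j
    rw [hQ, Matrix.mul_diagonal] at a1
    rw [hQ, Matrix.diagonal_mul] at a2
    have : Y i j ∈ Set.range ι := by rw [hr]; show p * Y i j * p = Y i j; rw [a2, a1]
    exact this
  choose z hz' using this
  have hzm : (Matrix.of z).map ι = Y := by ext i j; simp [hz']
  refine ⟨Matrix.of z, ?_⟩
  ext i j
  apply hinj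
  have := congrFun (congrFun hYY i) j
  rw [Matrix.map_apply] at this
  rw [← this]
  have hYs' : ∀ i j, star (Y j i) = Y i j := fun i j => congrFun (congrFun hYs i) j
  rw [Matrix.mul_apply, Matrix.mul_apply, map_sum]
  refine Finset.sum_congr rfl fun l _ => ?_
  rw [map_mul, Matrix.star_apply, map_star]
  simp [hz', hYs']

theorem cut_est {φ : F →ₗ[ℂ] D} {p : D} (hp : ‖p‖ ≤ 1) {t f q : F} {ε : ℝ} (hε : 0 ≤ ε) (ht : ∀ b, ‖φ (t * b) - p * φ b‖ ≤ ε * ‖b‖)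
    (hq : t - q = t * ((1 - t) * f)) (hf : ‖f‖ ≤ 2) (hf1 : ‖(1 - t) * f‖ ≤ 1) (hpp : p * p = p) (b : F) :
    ‖φ (q * b) - p * φ b‖ ≤ 4 * ε * ‖b‖ := by
  have e1 : q * b = t * b - t * (((1 - t) * f) * b) := by
    have : q = t - t * ((1 - t) * f) := by rw [← hq]; abel
    rw [this]; noncomm_ring
  have e2 : ((1 - t) * f) * b = f * b - t * (f * b) := by noncomm_ring
  have e3 : φ (q * b) - p * φ b = (φ (t * b) - p * φ b) - (φ (t * (((1 - t) * f) * b)) - p * φ (((1 - t) * f) * b))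
      + p * (φ (t * (f * b)) - p * φ (f * b)) := by
    rw [e1, map_sub]
    have : p * φ ((1 - t) * f * b) = p * φ (f * b) - p * φ (t * (f * b)) := by rw [e2, map_sub, mul_sub]
    rw [this]
    have : p * (φ (t * (f * b)) - p * φ (f * b)) = p * φ (t * (f * b)) - p * φ (f * b) := by rw [mul_sub, ← mul_assoc p p, hpp]
    rw [this]; abel
  rw [e3]
  have b0 : 0 ≤ ‖b‖ := norm_nonneg b
  have h1 := ht b
  have h2 : ‖φ (t * (((1 - t) * f) * b)) - p * φ (((1 - t) * f) * b)‖ ≤ ε * ‖b‖ := by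
    refine (ht _).trans ?_
    gcongr
    exact (norm_mul_le _ _).trans (mul_le_of_le_one_left b0 hf1)
  have h3 : ‖p * (φ (t * (f * b)) - p * φ (f * b))‖ ≤ ε * (2 * ‖b‖) := by
    refine (norm_mul_le _ _).trans ((mul_le_of_le_one_left (norm_nonneg _) hp).trans ((ht _).trans ?_))
    gcongr
    exact (norm_mul_le _ _).trans (by gcongr)
  refine (norm_add_le _ _).trans ?_
  have := norm_sub_le (φ (t * b) - p * φ b) (φ (t * (((1 - t) * f) * b)) - p * φ (((1 - t) * f) * b))
  linarith

theorem APd.corner {n : ℕ} {c : Fin (n + 1) → F} {c' : Fin (n + 1) → F'} (hcc : ∀ j x, c' j * x = x * c' j)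
    (hci : ∀ j, c' j * c' j = c' j)
    (hco : ∀ i j, i ≠ j → c' i * c' j = 0) (hcs : ∀ j, star (c' j) = c' j) (hsum : ∑ j, c' j = 1)
    {φ : F →ₗ[ℂ] D} {K : D → ℝ} {S : Finset D} {ε : ℝ} (hε : 0 ≤ ε) (h : APd c φ K S ε)
    {p : D} (ι : D' →⋆ₙₐ[ℂ] D) (hinj : Function.Injective ι) (h1 : ι 1 = p)
    (hr : Set.range ι = {x | p * x * p = x})
    (Θ : F' →ₗ[ℂ] F) (Ψ : F → F') (hΘm : ∀ x y, Θ (x * y) = Θ x * Θ y) (hΘs : ∀ x, Θ (star x) = star (Θ x))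
    (hΘn : ∀ x, ‖Θ x‖ ≤ ‖x‖) (hΨn : ∀ y, ‖Ψ y‖ ≤ ‖y‖) (hΨs : ∀ y, Ψ (star y) = star (Ψ y))
    (hΘΨ : ∀ y, Θ (Ψ y) = Θ 1 * y * Θ 1) (hΘc : ∀ j, Θ (c' j) = c j * Θ 1)
    (hq : ∀ b, ‖φ (Θ 1 * b) - p * φ b‖ ≤ 4 * ε * ‖b‖)
    {γ δ η : ℝ} (hγ : 0 < γ) (hδ : 5 * ε ≤ δ) (hδγ : δ / γ ≤ 3 / 4)
    (hη : 2 * ((n : ℝ) + 1) * (4 * Real.sqrt (δ / γ) + Real.sqrt (2 * γ)) ≤ η)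
    {S' : Finset D'} (hS : ∀ a ∈ S', ι a ∈ S) {ε' : ℝ} (e1 : η + 5 * ε ≤ ε')
    (e2 : ∀ a ∈ S', η * (K (ι a) + ‖a‖) + (4 * K (ι a) + 1) * ε ≤ ε') :
    ∃ φ' : F' →ₗ[ℂ] D', APd c' φ' (fun a => K (ι a)) S' ε' := by
  have hps : star p = p := by rw [← h1, ← map_star, star_one]
  have hpp : p * p = p := by rw [← h1, ← map_mul, mul_one]
  have hpn := proj_norm_le hpp hps
  have hιp : ∀ x, p * ι x = ι x := fun x => by rw [← h1, ← map_mul, one_mul]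
  have hιn : ∀ x, ‖ι x‖ = ‖x‖ := fun x => NonUnitalStarAlgHom.norm_map ι hinj x
  have hqq : Θ 1 * Θ 1 = Θ 1 := by rw [← hΘm, mul_one]
  have hqs : star (Θ 1) = Θ 1 := by rw [← hΘs, star_one]
  have hqΘ : ∀ x, Θ 1 * Θ x = Θ x := fun x => by rw [← hΘm, one_mul]
  let φ₁ : F' →ₗ[ℂ] D := φ ∘ₗ Θ
  have hφ₁ : ∀ x, φ₁ x = φ (Θ x) := fun x => rfl
  have hcp : IsCompletelyPositive φ₁ := cp_comp h.cp (cp_hom' _ hΘm hΘs)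
  have hle : φ₁ 1 ≤ 1 := (cp_mono h.cp (proj_le_one hqq hqs)).trans h.le_one
  have hcx : ∀ j x, Θ (c' j * x) = c j * Θ x := fun j x => by rw [hΘm, hΘc, mul_assoc, hqΘ]
  have hsoz : ∀ j x y, φ₁ (c' j * x) * φ₁ (c' j * y) = φ₁ (c' j) * φ₁ (c' j * (x * y)) := by
    intro j x y
    simp only [hφ₁, hcx, hΘc]
    rw [h.soz, h.soz, hqΘ, hΘm]
  have hnear : ‖φ₁ 1 - p‖ ≤ 5 * ε := by
    have a1 := hq 1
    rw [mul_one] at a1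
    have n1 : ‖(1 : F)‖ ≤ 1 := norm_one_le'
    have a2 : ‖p * (φ 1 - 1)‖ ≤ ε := (norm_mul_le _ _).trans ((mul_le_of_le_one_left (norm_nonneg _) hpn).trans h.near)
    have e : φ₁ 1 - p = (φ (Θ 1) - p * φ 1) + p * (φ 1 - 1) := by rw [hφ₁, mul_sub, mul_one]; abel
    rw [e]
    refine (norm_add_le _ _).trans ?_
    have : 4 * ε * ‖(1 : F)‖ ≤ 4 * ε := mul_le_of_le_one_right (by positivity) n1
    linarith
  obtain ⟨φ₂, hcp2, hle2, hran, hsoz2, hcl⟩ := lemC hcc hci hco hcs hsum hcp hle hsoz hpp hps hγ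
    ((by positivity : 0 ≤ 5 * ε).trans hδ) hδγ (hnear.trans hδ)
  have hcl' : ∀ x, ‖φ₂ x - φ₁ x‖ ≤ η * ‖x‖ := fun x => (hcl x).trans (by gcongr)
  have hη0 : 0 ≤ η := le_trans (by positivity) hη
  have : ∀ x, ∃ z, ι z = φ₂ x := by
    intro x
    have : φ₂ x ∈ Set.range ι := by rw [hr]; exact hran x
    exact this
  choose g hg using this
  let φ' : F' →ₗ[ℂ] D' :=
    { toFun := g
      map_add' := fun x y => hinj (by rw [map_add, hg, hg, hg, map_add])
      map_smul' := fun a x => hinj (by rw [hg, map_smul, map_smul]; simp [hg]) }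
  have hφ' : ∀ x, ι (φ' x) = φ₂ x := hg
  have hcp' : IsCompletelyPositive φ' := by
    intro k x hx
    apply corner_pos ι hinj h1 hr
    have : (x.map φ').map ι = x.map φ₂ := by ext i j; simp [hφ']
    rw [this]
    exact hcp2 k x hx
  refine ⟨φ', hcp', ?_, ?_, ?_, ?_⟩
  · rw [← CStarAlgebra.norm_le_one_iff_of_nonneg _ (cp_nonneg hcp' zero_le_one), ← hιn, hφ']
    exact (cp_contr hcp2 hle2 1).trans norm_one_le'
  · rw [← hιn, map_sub, hφ', h1]
    have e : φ₂ 1 - p = (φ₂ 1 - φ₁ 1) + (φ₁ 1 - p) := by abel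
    rw [e]
    refine (norm_add_le _ _).trans ?_
    have n1 : ‖(1 : F')‖ ≤ 1 := norm_one_le'
    have := hcl' 1
    have : η * ‖(1 : F')‖ ≤ η := mul_le_of_le_one_right hη0 n1
    linarith
  · intro j x y
    apply hinj
    rw [map_mul ι, map_mul ι]
    simp only [hφ']
    exact hsoz2 j x y
  · intro a ha
    obtain ⟨y, hy1, hy2, hy3⟩ := h.app _ (hS a ha)
    set k := K (ι a) with hk
    have hk0 : 0 ≤ k := (norm_nonneg y).trans hy1
    have aux : ∀ (y : F) (a : D'), ‖y‖ ≤ k → (∀ b, ‖φ (y * b) - ι a * φ b‖ ≤ ε * ‖b‖) →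
        ∀ b, ‖φ' (Ψ y * b) - a * φ' b‖ ≤ (η * (k + ‖a‖) + (4 * k + 1) * ε) * ‖b‖ := by
      intro y a hy hyb b
      rw [← hιn, map_sub, map_mul ι, hφ', hφ']
      have c1 : ‖φ₁ (Ψ y * b) - ι a * φ₁ b‖ ≤ (4 * k + 1) * ε * ‖b‖ := by
        have d0 : Θ (Ψ y * b) = Θ 1 * (y * Θ b) := by rw [hΘm, hΘΨ]; simp only [mul_assoc, hqΘ]
        have d1 : φ₁ (Ψ y * b) - ι a * φ₁ b = (φ (Θ 1 * (y * Θ b)) - p * φ (y * Θ b)) + p * (φ (y * Θ b) - ι a * φ (Θ b)) := by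
          rw [hφ₁, hφ₁, d0, mul_sub, ← mul_assoc p, hιp]; abel
        rw [d1]
        refine (norm_add_le _ _).trans ?_
        have d2 := hΘn b
        have d3 : ‖φ (Θ 1 * (y * Θ b)) - p * φ (y * Θ b)‖ ≤ 4 * ε * (k * ‖b‖) := by
          refine (hq _).trans ?_
          gcongr
          exact (norm_mul_le _ _).trans (by gcongr)
        have d4 : ‖p * (φ (y * Θ b) - ι a * φ (Θ b))‖ ≤ ε * ‖b‖ := by
          refine (norm_mul_le _ _).trans ((mul_le_of_le_one_left (norm_nonneg _) hpn).trans ((hyb _).trans (by gcongr)))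
        linarith
      have e : φ₂ (Ψ y * b) - ι a * φ₂ b = (φ₂ (Ψ y * b) - φ₁ (Ψ y * b)) - ι a * (φ₂ b - φ₁ b) + (φ₁ (Ψ y * b) - ι a * φ₁ b) := by
        rw [mul_sub]; abel
      rw [e]
      have c2 : ‖φ₂ (Ψ y * b) - φ₁ (Ψ y * b)‖ ≤ η * (k * ‖b‖) := by
        refine (hcl' _).trans ?_
        gcongr
        refine (norm_mul_le _ _).trans ?_
        have := (hΨn y).trans hy
        gcongr
      have c3 : ‖ι a * (φ₂ b - φ₁ b)‖ ≤ ‖a‖ * (η * ‖b‖) := by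
        refine (norm_mul_le _ _).trans ?_
        rw [hιn]
        gcongr
        exact hcl' b
      refine (norm_add_le _ _).trans ?_
      have := norm_sub_le (φ₂ (Ψ y * b) - φ₁ (Ψ y * b)) (ι a * (φ₂ b - φ₁ b))
      linarith
    refine ⟨Ψ y, (hΨn y).trans hy1, fun b => ?_, fun b => ?_⟩
    · exact (aux y a hy1 hy2 b).trans (mul_le_mul_of_nonneg_right (e2 a ha) (norm_nonneg b))
    · rw [← hΨs]
      have := aux (star y) (star a) (by rwa [norm_star]) (by rwa [map_star]) b
      rw [norm_star] at this
      exact this.trans (mul_le_mul_of_nonneg_right (e2 a ha) (norm_nonneg b))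

theorem ap_corner {n : ℕ} {p : D} (ι : D' →⋆ₙₐ[ℂ] D) (hinj : Function.Injective ι) (h1 : ι 1 = p)
    (hr : Set.range ι = {x | p * x * p = x}) (h : APb n D) : APb n D' := by
  classical
  obtain ⟨K, hK⟩ := h
  refine ⟨fun a => K (ι a), fun S ε' hε' => ?_⟩
  have hps : star p = p := by rw [← h1, ← map_star, star_one]
  have hpp : p * p = p := by rw [← h1, ← map_mul, mul_one]
  have hpn := proj_norm_le hpp hps
  set R : ℝ := ∑ a ∈ S, (|K (ι a)| + ‖a‖) with hR
  have hR0 : 0 ≤ R := Finset.sum_nonneg fun a _ => by positivity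
  have hRa : ∀ a ∈ S, K (ι a) + ‖a‖ ≤ R := fun a ha =>
    (add_le_add_left (le_abs_self _) _).trans (Finset.single_le_sum (f := fun a => |K (ι a)| + ‖a‖) (fun a _ => by positivity) ha)
  set η := ε' / (2 * (R + 1)) with hη
  have hη0 : 0 < η := by positivity
  have hηR : η * (R + 1) = ε' / 2 := by rw [hη]; field_simp
  obtain ⟨γ, δ, hγ, hδ, hγδ, hτ⟩ := exists_gd n hη0
  set ε := min (δ / 5) (ε' / (2 * (4 * R + 5))) with hε
  have hε0 : 0 < ε := by positivity
  have hεR : ε * (4 * R + 5) ≤ ε' / 2 := by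
    calc ε * (4 * R + 5) ≤ (ε' / (2 * (4 * R + 5))) * (4 * R + 5) := by gcongr; exact min_le_right _ _
      _ = _ := by field_simp
  obtain ⟨I, _, _, m, _, _, J, φ, hφ⟩ := hK (insert p (S.image ι)) ε hε0
  obtain ⟨y, hy1, hy2, hy3⟩ := hφ.app p (by simp)
  rw [hps] at hy3
  set t : Blk m := (1 / 2 : ℂ) • (y + star y) with ht
  have hts : star t = t := by
    rw [ht, star_smul, star_add, star_star, add_comm]; congr 1; simp
  have htb : ∀ b, ‖φ (t * b) - p * φ b‖ ≤ ε * ‖b‖ := by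
    intro b
    have e : φ (t * b) - p * φ b = (1 / 2 : ℂ) • ((φ (y * b) - p * φ b) + (φ (star y * b) - p * φ b)) := by
      rw [ht, smul_mul_assoc, add_mul, map_smul, map_add, smul_add, smul_add, smul_sub, smul_sub]
      have : p * φ b = (1 / 2 : ℂ) • (p * φ b) + (1 / 2 : ℂ) • (p * φ b) := by rw [← add_smul]; norm_num
      nth_rewrite 1 [this]; abel
    rw [e, norm_smul]
    have := norm_add_le (φ (y * b) - p * φ b) (φ (star y * b) - p * φ b)
    have h2 : ‖(1 / 2 : ℂ)‖ = 1 / 2 := by norm_num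
    rw [h2]
    linarith [hy2 b, hy3 b]
  obtain ⟨m', i1, i2, Θ, Ψ, f, a1, a2, a3, a4, a5, a6, a7, a8, a9, a10⟩ := blk_cut J t hts
  have hq := cut_est hpn hε0.le htb a8 a9 a10 hpp
  have hco : ∀ i j, i ≠ j → cproj J i * cproj J j = (0 : Blk m') := by
    intro i j hij
    funext l
    by_cases h : J l = i
    · have : J l ≠ j := fun h' => hij (h.symm.trans h')
      simp [cproj, this]
    · simp [cproj, h]
  obtain ⟨φ', hφ'⟩ := APd.corner (fun j x => (cproj_comm J j x).symm) (cproj_idem J) hco (cproj_star J) (cproj_sum J) hε0.le hφ ι hinj h1 hr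
    Θ Ψ a1 a2 a3 a4 a5 a6 a7 hq hγ (S' := S) (ε' := ε') (by have := min_le_left (δ / 5) (ε' / (2 * (4 * R + 5))); linarith) hγδ hτ
    (fun a ha => by simp only [Finset.mem_insert, Finset.mem_image]; exact Or.inr ⟨a, ha, rfl⟩)
    (by nlinarith) (by
      intro a ha
      have b1 := hRa a ha
      have b2 := norm_nonneg a
      have b3 : η * (K (ι a) + ‖a‖) ≤ η * R := by gcongr
      have b4 : (4 * K (ι a) + 1) * ε ≤ (4 * R + 5) * ε := by gcongr <;> linarith
      nlinarith)
  exact ⟨I, inferInstance, inferInstance, m', i1, i2, J, φ', hφ'⟩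
end Corner

section FS

theorem finsat_ap {n : ℕ} {B : CStarAlg} (h : FinSat (drClass n) B) : APb n B.carrier := by
  induction h with
  | base h => exact ap_base h.2
  | iso _ e ih => exact ap_iso e.some.symm ih
  | sum _ _ e ih1 ih2 => exact ap_iso e.some.symm (ap_sum ih1 ih2)
  | matrix k _ e ih => exact ap_mat e.some ih
  | corner p _ _ _ _ h ih =>
    obtain ⟨ι, h1, h2, h3⟩ := h
    exact ap_corner ι h1 h2 h3 ih

theorem local_ap {n : ℕ} {D : Type} [CStarAlgebra D] (h : IsUnitalLocalAlg (drClass n) D) (S : Finset D) {ε : ℝ} (hε : 0 < ε) :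
    ∃ K, AP n D K S ε := by
  classical
  obtain ⟨B, hB, π, hπ⟩ := h S (ε / 2) (by positivity)
  obtain ⟨K, hK⟩ := finsat_ap hB
  choose! b hb using hπ
  obtain ⟨I, _, _, m, _, _, J, φ, hφ⟩ := hK (S.image b) (ε / 2) (by positivity)
  have := APd.push (ε' := ε / 2) (S' := S) (K' := fun a => K (b a)) (by positivity) π hφ
    (fun a ha => ⟨b a, Finset.mem_image_of_mem _ ha, (hb a ha).le, le_rfl⟩)
  rw [add_halves] at this
  exact ⟨fun a => K (b a), I, inferInstance, inferInstance, m, inferInstance, inferInstance, J, _, this⟩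
end FS

section States
variable {D : Type*} [CStarAlgebra D]

theorem norm_one_add_of_nonneg [Nontrivial D] {b : D} (hb : 0 ≤ b) : ‖1 + b‖ = 1 + ‖b‖ := by
  refine le_antisymm ((norm_add_le _ _).trans (by simp)) ?_
  have h1 : (1:ℝ) ≤ ‖1 + b‖ := by
    have := le_of_nonneg_norm (a := (1:D)) (b := 1 + b) zero_le_one (by simpa using hb)
    simpa using this
  have h2 : 1 + b ≤ algebraMap ℝ D ‖1 + b‖ :=
    IsSelfAdjoint.le_algebraMap_norm_self (IsSelfAdjoint.of_nonneg (add_nonneg zero_le_one hb))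
  have h3 : b ≤ algebraMap ℝ D (‖1 + b‖ - 1) := by
    rw [map_sub, map_one, le_sub_iff_add_le, add_comm]; exact h2
  have h4 := le_of_nonneg_norm hb h3
  rw [norm_algebraMap', Real.norm_of_nonneg (by linarith)] at h4
  linarith

theorem state_im {g : StrongDual ℂ D} (hg : ‖g‖ ≤ 1) (h1 : g 1 = 1) {a : D} (ha : IsSelfAdjoint a) : (g a).im = 0 := by
  have key : ∀ t : ℝ, 2 * (g a).im * t + (g a).im ^ 2 ≤ ‖a‖ ^ 2 := by
    intro t
    have h2 : ‖a + (t * Complex.I : ℂ) • 1‖ ^ 2 ≤ ‖a‖ ^ 2 + t ^ 2 := by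
      rw [sq, ← CStarRing.norm_star_mul_self]
      have : star (a + (t * Complex.I : ℂ) • 1) * (a + (t * Complex.I : ℂ) • 1) = star a * a + ((t ^ 2 : ℝ) : ℂ) • (1 : D) := by
        simp only [star_add, star_smul, star_one, ha.star_eq, add_mul, mul_add, smul_mul_assoc, mul_smul_comm, one_mul, mul_one, smul_smul]
        have e1 : star (t * Complex.I : ℂ) = - (t * Complex.I) := by simp
        have e2 : - (t * Complex.I : ℂ) * (t * Complex.I) = ((t ^ 2 : ℝ) : ℂ) := by
          push_cast; linear_combination (-(t:ℂ)^2) * Complex.I_sq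
        have e3 : (t * Complex.I : ℂ) * (-(t * Complex.I)) = ((t ^ 2 : ℝ) : ℂ) := by
          rw [← e2]; ring
        rw [e1]
        rw [← e2]
        module
      rw [this]
      refine (norm_add_le _ _).trans (add_le_add ?_ ?_)
      · rw [CStarRing.norm_star_mul_self, sq]
      · rw [norm_smul, Complex.norm_real, Real.norm_of_nonneg (by positivity)]
        exact mul_le_of_le_one_right (by positivity) norm_one_le'
    have h3 : ‖g (a + (t * Complex.I : ℂ) • 1)‖ ≤ ‖a + (t * Complex.I : ℂ) • 1‖ :=
      (g.le_opNorm _).trans (mul_le_of_le_one_left (norm_nonneg _) hg)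
    have h4 : ((g a).im + t) ^ 2 ≤ ‖g (a + (t * Complex.I : ℂ) • 1)‖ ^ 2 := by
      rw [map_add, map_smul, h1, Complex.sq_norm, Complex.normSq_apply]
      simp
      nlinarith [sq_nonneg (g a).re]
    have h5 := pow_le_pow_left₀ (norm_nonneg _) h3 2
    nlinarith
  by_contra h
  have := key ((‖a‖ ^ 2 + 1) / (2 * (g a).im))
  have e : 2 * (g a).im * ((‖a‖ ^ 2 + 1) / (2 * (g a).im)) = ‖a‖ ^ 2 + 1 := by field_simp
  nlinarith [sq_nonneg (g a).im]

theorem state_nonneg {g : StrongDual ℂ D} (hg : ‖g‖ ≤ 1) (h1 : g 1 = 1) {a : D} (ha : 0 ≤ a) : 0 ≤ g a := by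
  have hsa := IsSelfAdjoint.of_nonneg ha
  have him := state_im hg h1 hsa
  have h2 : ‖algebraMap ℝ D ‖a‖ - a‖ ≤ ‖a‖ := by
    have := le_of_nonneg_norm (a := algebraMap ℝ D ‖a‖ - a) (b := algebraMap ℝ D ‖a‖)
      (sub_nonneg.mpr (IsSelfAdjoint.le_algebraMap_norm_self hsa)) (sub_le_self _ ha)
    refine this.trans ?_
    rw [Algebra.algebraMap_eq_smul_one, norm_smul, norm_norm]
    exact mul_le_of_le_one_right (by positivity) norm_one_le'
  have h3 : ‖g (algebraMap ℝ D ‖a‖ - a)‖ ≤ ‖a‖ :=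
    (g.le_opNorm _).trans ((mul_le_of_le_one_left (norm_nonneg _) hg).trans h2)
  have h4 : g (algebraMap ℝ D ‖a‖) = ‖a‖ := by
    rw [Algebra.algebraMap_eq_smul_one, ← Complex.coe_smul, map_smul, h1]; simp
  rw [map_sub, h4] at h3
  have h5 := (Complex.abs_re_le_norm _).trans h3
  rw [Complex.sub_re, Complex.ofReal_re] at h5
  rw [Complex.le_def]
  have := (abs_le.mp h5).2
  constructor
  · simp; linarith
  · simp [him]

theorem exists_state {b : D} (hb : 0 ≤ b) (hb0 : b ≠ 0) : ∃ g : StrongDual ℂ D, ‖g‖ ≤ 1 ∧ g b = ‖b‖ ∧ ∀ a, 0 ≤ a → 0 ≤ g a := by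
  have : Nontrivial D := ⟨b, 0, hb0⟩
  have hn := norm_one_add_of_nonneg hb
  obtain ⟨g, hg, hg2⟩ := exists_dual_vector'' ℂ (1 + b)
  have hA : ‖g 1‖ ≤ 1 := (g.le_opNorm _).trans (by simpa using hg)
  have hB : ‖g b‖ ≤ ‖b‖ := (g.le_opNorm _).trans (mul_le_of_le_one_left (norm_nonneg _) hg)
  have hr : (g 1).re + (g b).re = 1 + ‖b‖ := by
    rw [← Complex.add_re, ← map_add, hg2, hn]; simp
  have hA' := Complex.re_le_norm (g 1)
  have hB' := Complex.re_le_norm (g b)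
  have aux : ∀ (z : ℂ) (r : ℝ), ‖z‖ ≤ r → z.re = r → z = r := by
    intro z r h1 h2
    have h0 : 0 ≤ r := (norm_nonneg z).trans h1
    have h3 : z.re ^ 2 + z.im ^ 2 ≤ r ^ 2 := by
      have := pow_le_pow_left₀ (norm_nonneg _) h1 2
      rw [Complex.sq_norm, Complex.normSq_apply] at this
      nlinarith
    have h4 : z.im = 0 := by rw [h2] at h3; nlinarith [sq_nonneg z.im]
    apply Complex.ext <;> simp [h2, h4]
  have hg1 : g 1 = 1 := by have := aux _ 1 hA (by linarith); simpa using this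
  exact ⟨g, hg, aux _ _ hB (by linarith), fun a ha => state_nonneg hg hg1 ha⟩

theorem cp_state {g : D →ₗ[ℂ] ℂ} (hg : ∀ a, 0 ≤ a → 0 ≤ g a) : IsCompletelyPositive g := by
  intro k x hx
  obtain ⟨y, rfl⟩ := hx
  have hsa : ∀ a, g (star a) = star (g a) := by
    intro a
    have hr : ∀ a : D, IsSelfAdjoint a → star (g a) = g a := by
      intro a ha
      have h1 : a = a⁺ - a⁻ := (CFC.posPart_sub_negPart a ha).symm
      rw [h1, map_sub, star_sub, (IsSelfAdjoint.of_nonneg (hg _ (CFC.posPart_nonneg a))).star_eq,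
        (IsSelfAdjoint.of_nonneg (hg _ (CFC.negPart_nonneg a))).star_eq]
    have h1 := realPart_add_I_smul_imaginaryPart a
    have h2 := hr _ (realPart a).2
    have h3 := hr _ (imaginaryPart a).2
    rw [← h1]
    simp only [star_add, star_smul, map_add, map_smul, h2, h3, (realPart a).2.star_eq,
      (imaginaryPart a).2.star_eq]
  have key : ∀ ξ : Fin k → ℂ, dotProduct (star ξ) (Matrix.mulVec ((star y * y).map g) ξ) = g (∑ r, star (∑ i, ξ i • y r i) * (∑ i, ξ i • y r i)) := by
    intro ξ
    simp only [dotProduct, Matrix.mulVec, Matrix.map_apply, Matrix.mul_apply, Matrix.star_apply, map_sum, star_sum, Finset.sum_mul,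
      Finset.mul_sum, star_smul, smul_mul_assoc, mul_smul_comm, map_smul, Pi.star_apply, smul_eq_mul]
    rw [Finset.sum_comm_cycle]
    refine Finset.sum_congr rfl fun r _ => ?_
    rw [Finset.sum_comm]
    refine Finset.sum_congr rfl fun i _ => ?_
    refine Finset.sum_congr rfl fun j _ => ?_
    ring
  have h0 : ∀ ξ : Fin k → ℂ, 0 ≤ dotProduct (star ξ) (Matrix.mulVec ((star y * y).map g) ξ) := by
    intro ξ
    rw [key]
    exact hg _ (Finset.sum_nonneg fun r _ => star_mul_self_nonneg _)
  have hps : ((star y * y).map g).PosSemidef := by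
    refine Matrix.PosSemidef.of_dotProduct_mulVec_nonneg ?_ h0
    ext i j
    rw [Matrix.conjTranspose_apply, Matrix.map_apply, Matrix.map_apply, ← hsa]
    have : star (star y * y) i j = (star y * y) i j := by rw [star_mul, star_star]
    rw [← this, Matrix.star_apply]
  open scoped MatrixOrder in
  have := CStarAlgebra.nonneg_iff_eq_star_mul_self.mp hps.nonneg
  exact this
end States

section BlockMap
variable {D : Type*} [CStarAlgebra D]

def sandwich {r : ℕ} (u : Fin r → D) : D →ₗ[ℂ] Matrix (Fin r) (Fin r) D where
  toFun x := Matrix.of fun k l => star (u k) * x * u l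
  map_add' x y := by ext; simp [mul_add, add_mul]
  map_smul' t x := by ext; simp

theorem cp_sandwich {r : ℕ} (u : Fin r → D) : IsCompletelyPositive (sandwich u) := by
  intro N X hX
  obtain ⟨Y, rfl⟩ := hX
  by_cases hr : r = 0
  · subst hr; exact ⟨0, by ext a b k; exact k.elim0⟩
  have : NeZero r := ⟨hr⟩
  refine ⟨Matrix.of fun p q => Matrix.of fun k l => if k = 0 then Y p q * u l else 0, ?_⟩
  ext p q k l
  simp only [Matrix.map_apply, sandwich, LinearMap.coe_mk, AddHom.coe_mk, Matrix.of_apply, Matrix.mul_apply, Matrix.star_apply,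
    Matrix.sum_apply]
  rw [Finset.mul_sum, Finset.sum_mul]
  refine Finset.sum_congr rfl fun a _ => ?_
  rw [Finset.sum_eq_single 0]
  · simp [mul_assoc]
  · intro b _ hb; simp [hb]
  · simp

theorem ortho_norm {r : ℕ} {u : Fin r → D} {b : D} (hu : ∀ k l, star (u k) * u l = if k = l then b else 0)
    (ζ : EuclideanSpace ℂ (Fin r)) : ‖∑ k, ζ k • u k‖ ^ 2 ≤ ‖ζ‖ ^ 2 * ‖b‖ := by
  rw [sq, ← CStarRing.norm_star_mul_self]
  have : star (∑ k, ζ k • u k) * (∑ k, ζ k • u k) = ((‖ζ‖ ^ 2 : ℝ) : ℂ) • b := by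
    simp only [star_sum, Finset.sum_mul, Finset.mul_sum, star_smul, smul_mul_assoc, mul_smul_comm, hu, smul_ite, smul_zero,
      Finset.sum_ite_eq, Finset.sum_ite_eq', Finset.mem_univ, if_true, smul_smul]
    rw [← Finset.sum_smul, EuclideanSpace.norm_sq_eq]
    congr 1
    push_cast
    refine Finset.sum_congr rfl fun i _ => ?_
    first
      | exact Complex.conj_mul' _
      | exact Complex.mul_conj' _
  rw [this, norm_smul, Complex.norm_real, Real.norm_of_nonneg (by positivity)]

theorem exists_blockmap {r : ℕ} {u : Fin r → D} {b : D} (hu : ∀ k l, star (u k) * u l = if k = l then b else 0)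
    (hb : 0 ≤ b) (hb0 : b ≠ 0) :
    ∃ ψ : D →ₗ[ℂ] Matrix (Fin r) (Fin r) ℂ, IsCompletelyPositive ψ ∧ ψ 1 = 1 ∧
      ∀ (a : D) (Y : Matrix (Fin r) (Fin r) ℂ) (δ : ℝ), 0 ≤ δ → 
        (∀ ξ : EuclideanSpace ℂ (Fin r), ‖a * (∑ l, ξ l • u l) - ∑ l, ξ l • ∑ k, Y k l • u k‖ ≤ δ * ‖ξ‖) →
        ‖ψ a - Y‖ ≤ δ / Real.sqrt ‖b‖ := by
  obtain ⟨g, hg, hgb, hgp⟩ := exists_state hb hb0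
  have hbn : 0 < ‖b‖ := norm_pos_iff.mpr hb0
  have hbc : ((‖b‖:ℝ):ℂ) ≠ 0 := by exact_mod_cast hbn.ne'
  let g' : D →ₗ[ℂ] ℂ := (((‖b‖⁻¹ : ℝ)) : ℂ) • (g : D →ₗ[ℂ] ℂ)
  have hg' : ∀ x, g' x = (‖b‖:ℂ)⁻¹ * g x := fun x => by simp [g']
  have hcp : IsCompletelyPositive g' := cp_state fun a ha => by
    rw [hg']
    refine mul_nonneg ?_ (hgp a ha)
    rw [← Complex.ofReal_inv]
    exact_mod_cast (inv_nonneg.mpr hbn.le)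
  have hg'b : g' b = 1 := by rw [hg', hgb]; exact inv_mul_cancel₀ hbc
  have hg'n : ∀ x, ‖g' x‖ ≤ ‖b‖⁻¹ * ‖x‖ := by
    intro x
    rw [hg', norm_mul, norm_inv, Complex.norm_real, norm_norm]
    exact mul_le_mul_of_nonneg_left ((g.le_opNorm _).trans (mul_le_of_le_one_left (norm_nonneg _) hg)) (by positivity)
  refine ⟨matMapL r g' ∘ₗ sandwich u, cp_comp (cp_matMap hcp) (cp_sandwich u), ?_, ?_⟩
  · ext k l
    simp only [matMapL, sandwich, LinearMap.comp_apply, LinearMap.coe_mk, AddHom.coe_mk, Matrix.map_apply, Matrix.of_apply, mul_one, hu,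
      Matrix.one_apply]
    split_ifs <;> simp [hg'b]
  intro a Y δ hδ h
  set X := (matMapL r g' ∘ₗ sandwich u) a - Y with hX
  have hXkl : ∀ k l, X k l = g' (star (u k) * (a * u l - ∑ m, Y m l • u m)) := by
    intro k l
    rw [mul_sub, map_sub, Finset.mul_sum]
    simp only [mul_smul_comm, hu, smul_ite, smul_zero, Finset.sum_ite_eq, Finset.mem_univ, if_true, map_smul, hg'b]
    simp [hX, matMapL, sandwich, mul_assoc]
  rw [Matrix.l2_opNorm_def]
  refine ContinuousLinearMap.opNorm_le_bound _ (by positivity) fun ξ => ?_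
  set ζ : EuclideanSpace ℂ (Fin r) := (Matrix.toEuclideanLin.trans LinearMap.toContinuousLinearMap) X ξ with hζ
  have hζk : ∀ k, ζ k = ∑ l, X k l * ξ l := by
    intro k; simp [hζ, Matrix.toLpLin_apply, Matrix.mulVec, dotProduct]
  have e1 : ((‖ζ‖ ^ 2 : ℝ) : ℂ) = g' (star (∑ k, ζ k • u k) * (a * (∑ l, ξ l • u l) - ∑ l, ξ l • ∑ k, Y k l • u k)) := by
    have e2 : (a * (∑ l, ξ l • u l) - ∑ l, ξ l • ∑ k, Y k l • u k) = ∑ l, ξ l • (a * u l - ∑ k, Y k l • u k) := by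
      rw [Finset.mul_sum, ← Finset.sum_sub_distrib]
      refine Finset.sum_congr rfl fun l _ => ?_
      rw [smul_sub, mul_smul_comm]
    rw [e2, star_sum, Finset.sum_mul, map_sum, EuclideanSpace.norm_sq_eq]
    push_cast
    refine Finset.sum_congr rfl fun k _ => ?_
    rw [Finset.mul_sum, map_sum]
    simp only [star_smul, smul_mul_assoc, mul_smul_comm, map_smul, ← hXkl, smul_eq_mul]
    rw [← Complex.conj_mul']
    nth_rewrite 2 [hζk k]
    rw [Finset.mul_sum]
    refine Finset.sum_congr rfl fun l _ => ?_
    simp; ring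
  have e3 : ‖ζ‖ ^ 2 ≤ ‖b‖⁻¹ * ((‖ζ‖ * Real.sqrt ‖b‖) * (δ * ‖ξ‖)) := by
    have := congrArg norm e1
    rw [Complex.norm_real, Real.norm_of_nonneg (by positivity)] at this
    rw [this]
    refine (hg'n _).trans (mul_le_mul_of_nonneg_left ?_ (by positivity))
    refine (norm_mul_le _ _).trans (mul_le_mul ?_ (h ξ) (norm_nonneg _) (by positivity))
    rw [norm_star]
    refine abs_le_of_sq_le_sq' ?_ (by positivity) |>.2
    rw [mul_pow, Real.sq_sqrt (norm_nonneg _)]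
    exact ortho_norm hu ζ
  have hs : 0 < Real.sqrt ‖b‖ := Real.sqrt_pos.mpr hbn
  have e4 : ‖b‖⁻¹ * ((‖ζ‖ * Real.sqrt ‖b‖) * (δ * ‖ξ‖)) = ‖ζ‖ * (δ / Real.sqrt ‖b‖ * ‖ξ‖) := by
    have : ‖b‖ = Real.sqrt ‖b‖ * Real.sqrt ‖b‖ := (Real.mul_self_sqrt hbn.le).symm
    nth_rewrite 1 [this]
    field_simp
  rw [e4] at e3
  by_cases hz : ‖ζ‖ = 0
  · rw [hz]; positivity
  · have hz' : 0 < ‖ζ‖ := lt_of_le_of_ne (norm_nonneg _) (Ne.symm hz)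
    rw [sq] at e3
    exact le_of_mul_le_mul_left e3 hz'
end BlockMap

section Final
variable {D : Type*} [CStarAlgebra D]

theorem sq_le_smul {x : D} (hx : 0 ≤ x) {η : ℝ} (h : ‖x‖ ≤ η) : x * x ≤ η • x := by
  obtain ⟨y, rfl⟩ := CStarAlgebra.nonneg_iff_eq_star_mul_self.mp hx
  have h1 : y * star y ≤ algebraMap ℝ D η := by
    have := star_mul_self_le (star y)
    rw [star_star, norm_star] at this
    refine this.trans ?_
    rw [← sub_nonneg, ← map_sub]
    refine algebraMap_nonneg D ?_
    rw [CStarRing.norm_star_mul_self, ← sq] at h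
    linarith
  have h2 := star_left_conjugate_le_conjugate h1 y
  rw [Algebra.algebraMap_eq_smul_one, mul_smul_comm, mul_one, smul_mul_assoc] at h2
  simpa only [mul_assoc] using h2

theorem ortho_sum_norm {ι : Type*} (T : Finset ι) (x : ι → D) {η : ℝ} (hη : 0 ≤ η) (hx : ∀ i ∈ T, 0 ≤ x i)
    (hn : ∀ i ∈ T, ‖x i‖ ≤ η) (ho : ∀ i ∈ T, ∀ j ∈ T, i ≠ j → x i * x j = 0) : ‖∑ i ∈ T, x i‖ ≤ η := by
  classical
  set X := ∑ i ∈ T, x i with hX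
  have hX0 : 0 ≤ X := Finset.sum_nonneg hx
  have h1 : X * X = ∑ i ∈ T, x i * x i := by
    rw [hX, Finset.sum_mul_sum]
    refine Finset.sum_congr rfl fun i hi => ?_
    rw [Finset.sum_eq_single_of_mem i hi]
    intro j hj hij
    exact ho i hi j hj hij.symm
  have h2 : X * X ≤ η • X := by
    rw [h1, hX, Finset.smul_sum]
    exact Finset.sum_le_sum fun i hi => sq_le_smul (hx i hi) (hn i hi)
  have h3 : 0 ≤ X * X := by
    have := star_mul_self_nonneg X
    rwa [(IsSelfAdjoint.of_nonneg hX0).star_eq] at this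
  have h4 := le_of_nonneg_norm h3 h2
  have h5 : ‖X * X‖ = ‖X‖ * ‖X‖ := by
    have := CStarRing.norm_star_mul_self (x := X)
    rwa [(IsSelfAdjoint.of_nonneg hX0).star_eq] at this
  rw [h5, norm_smul, Real.norm_of_nonneg hη] at h4
  by_cases hz : ‖X‖ = 0
  · rw [hz]; exact hη
  · exact le_of_mul_le_mul_right h4 (lt_of_le_of_ne (norm_nonneg _) (Ne.symm hz))

def EE {s : ℕ} {r : Fin s → ℕ} (i : Fin s) (k l : Fin (r i)) : Blk (fun i => Fin (r i)) := Pi.single i (Matrix.single k l 1)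

theorem EE_mul {s : ℕ} {r : Fin s → ℕ} (i : Fin s) (k l k' l' : Fin (r i)) :
    EE i k l * EE i k' l' = if l = k' then EE i k l' else 0 := by
  rw [EE, EE, ← Pi.single_mul]
  split_ifs with h
  · subst h; simp [EE]
  · simp [Matrix.single_mul_single_of_ne _ _ _ _ h]

theorem EE_mul_ne {s : ℕ} {r : Fin s → ℕ} {i i' : Fin s} (h : i ≠ i') (k l : Fin (r i)) (k' l' : Fin (r i')) :
    EE i k l * EE i' k' l' = 0 := by
  rw [EE, EE]
  ext1 q
  rw [Pi.mul_apply]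
  by_cases hq : q = i
  · subst hq; rw [Pi.single_eq_of_ne h, mul_zero]; rfl
  · rw [Pi.single_eq_of_ne hq, zero_mul]; rfl

theorem EE_star {s : ℕ} {r : Fin s → ℕ} (i : Fin s) (k l : Fin (r i)) : star (EE i k l) = EE i l k := by
  rw [EE, EE, ← Pi.single_star, Matrix.star_eq_conjTranspose, Matrix.conjTranspose_single, star_one]

theorem cproj_EE {s n : ℕ} {r : Fin s → ℕ} (J : Fin s → Fin (n + 1)) (i : Fin s) (k l : Fin (r i)) :
    cproj J (J i) * EE i k l = EE i k l := by
  ext1 q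
  rw [Pi.mul_apply]
  by_cases hq : q = i
  · subst hq; simp [cproj]
  · simp [EE, Pi.single_eq_of_ne hq]

theorem mul_EE {s : ℕ} {r : Fin s → ℕ} (y : Blk (fun i => Fin (r i))) (i : Fin s) (l o : Fin (r i)) :
    y * EE i l o = ∑ k, y i k l • EE i k o := by
  ext q a b
  simp only [Pi.mul_apply, Finset.sum_apply, Pi.smul_apply, Matrix.sum_apply, Matrix.smul_apply]
  by_cases hq : q = i
  · subst hq
    simp [EE, Matrix.mul_apply, Matrix.single, Finset.sum_ite, ite_and]
  · simp [EE, Pi.single_eq_of_ne hq]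

variable {n s : ℕ} {r : Fin s → ℕ} {J : Fin s → Fin (n + 1)} {φ : Blk (fun i => Fin (r i)) →ₗ[ℂ] D} {K : D → ℝ}
  {S : Finset D} {ε : ℝ}

theorem apd_EE (h : APd (cproj J) φ K S ε) (i : Fin s) (k l o : Fin (r i)) :
    star (φ (EE i k o)) * φ (EE i l o) = if k = l then φ (EE i o o) * φ (EE i o o) else 0 := by
  rw [← cp_star h.cp, EE_star]
  have h1 := h.soz (J i) (EE i o k) (EE i l o)
  have h2 := h.soz (J i) (EE i o o) (EE i o o)
  rw [cproj_EE, cproj_EE, EE_mul] at h1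
  rw [cproj_EE, EE_mul, if_pos rfl, cproj_EE] at h2
  rw [h1, h2]
  split_ifs with hkl
  · rw [cproj_EE]
  · simp

theorem apd_bad (h : APd (cproj J) φ K S ε) {η : ℝ} (hη : 0 ≤ η) (B : Finset (Fin s))
    (hB : ∀ i ∈ B, ∀ o, ‖φ (EE i o o)‖ ≤ η) : ‖φ (fun i => if i ∈ B then 1 else 0)‖ ≤ (n + 1) * η := by
  classical
  have e : (fun i => if i ∈ B then 1 else 0 : Blk (fun i => Fin (r i))) =
      ∑ j : Fin (n + 1), ∑ α ∈ (B.filter (fun i => J i = j)).sigma (fun i => (Finset.univ : Finset (Fin (r i)))), EE α.1 α.2 α.2 := by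
    have e1 : ∀ i : Fin s, ∑ o, EE i o o = (Pi.single i 1 : Blk (fun i => Fin (r i))) := by
      intro i
      have := mul_EE (1 : Blk (fun i => Fin (r i))) i
      ext q a b
      simp only [Finset.sum_apply, Matrix.sum_apply]
      by_cases hq : q = i
      · subst hq; simp [EE, Matrix.single, Matrix.one_apply, ite_and]
      · simp [EE, Pi.single_eq_of_ne hq]
    simp_rw [Finset.sum_sigma, e1]
    rw [Finset.sum_fiberwise]
    ext1 q
    rw [Finset.sum_apply]
    by_cases hq : q ∈ B
    · rw [Finset.sum_eq_single_of_mem q hq (fun b _ hb => Pi.single_eq_of_ne hb.symm _)]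
      simp [hq]
    · rw [Finset.sum_eq_zero]
      · simp [hq]
      · intro b hb
        exact Pi.single_eq_of_ne (fun hh : q = b => hq (hh.symm ▸ hb)) _
  rw [e, map_sum]
  refine (norm_sum_le _ _).trans ?_
  have : ∀ j ∈ (Finset.univ : Finset (Fin (n+1))), ‖φ (∑ α ∈ (B.filter (fun i => J i = j)).sigma (fun i => (Finset.univ : Finset (Fin (r i)))), EE α.1 α.2 α.2)‖ ≤ η := by
    intro j _
    rw [map_sum]
    have hp : ∀ i (o : Fin (r i)), φ (EE i o o) = star (φ (EE i o o)) := fun i o => by rw [← cp_star h.cp, EE_star]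
    refine ortho_sum_norm _ _ hη ?_ ?_ ?_
    · rintro ⟨i, o⟩ _
      refine cp_nonneg h.cp ((posElem_iff _).mp ⟨EE i o o, ?_⟩)
      rw [EE_star, EE_mul, if_pos rfl]
    · rintro ⟨i, o⟩ hi
      simp at hi
      exact hB i hi.1 o
    · rintro ⟨i, o⟩ hi ⟨i', o'⟩ hi' hne
      simp at hi hi'
      have h1 := h.soz j (EE i o o) (EE i' o' o')
      have a1 := cproj_EE J i o o
      have a2 := cproj_EE J i' o' o'
      rw [hi.2] at a1
      rw [hi'.2] at a2
      rw [a1, a2] at h1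
      show φ (EE i o o) * φ (EE i' o' o') = 0
      rw [h1]
      have : EE i o o * EE i' o' o' = 0 := by
        by_cases hii : i = i'
        · subst hii
          rw [EE_mul, if_neg]
          rintro rfl; exact hne rfl
        · exact EE_mul_ne hii _ _ _ _
      rw [this]; simp
  refine (Finset.sum_le_sum this).trans ?_
  simp

theorem cp_pi {ψ : ∀ i : Fin s, D →ₗ[ℂ] Matrix (Fin (r i)) (Fin (r i)) ℂ} (h : ∀ i, IsCompletelyPositive (ψ i)) :
    IsCompletelyPositive (LinearMap.pi ψ : D →ₗ[ℂ] Blk (fun i => Fin (r i))) := by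
  intro k x hx
  choose y hy using fun i => h i k x hx
  refine ⟨Matrix.of fun a b i => y i a b, ?_⟩
  ext a b i p q
  have := congrFun (congrFun (congrFun (congrFun (hy i) a) b) p) q
  simp only [Matrix.map_apply, LinearMap.pi_apply] at this ⊢
  rw [this]
  simp [Matrix.mul_apply, Matrix.star_apply, Matrix.sum_apply, Finset.sum_apply]

theorem dr_of_apd (h : APd (cproj J) φ K S ε) (hε : 0 ≤ ε) {η : ℝ} (hη : 0 < η) :
    ∃ ψ : D →ₗ[ℂ] Blk (fun i => Fin (r i)), IsCompletelyPositive ψ ∧ (∀ a, ‖ψ a‖ ≤ ‖a‖) ∧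
      ∀ a ∈ S, ‖φ (ψ a) - a‖ ≤ ε / η + ε + ‖a‖ * ((n + 1) * η) + ε + ‖a‖ * ε := by
  classical
  choose! y hyK hy _ using h.app
  have hex : ∀ i : Fin s, ∃ ψ : D →ₗ[ℂ] Matrix (Fin (r i)) (Fin (r i)) ℂ, IsCompletelyPositive ψ ∧
      ((∃ o, η < ‖φ (EE i o o)‖) → ψ 1 = 1 ∧ ∀ a ∈ S, ‖ψ a - y a i‖ ≤ ε / η) ∧
      ((¬ ∃ o, η < ‖φ (EE i o o)‖) → ψ = 0) := by
    intro i
    by_cases hg : ∃ o, η < ‖φ (EE i o o)‖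
    swap
    · exact ⟨0, cp_zero, fun h => absurd h hg, fun _ => rfl⟩
    obtain ⟨o, ho⟩ := hg
    have hsa : star (φ (EE i o o)) = φ (EE i o o) := by rw [← cp_star h.cp, EE_star]
    have hb : 0 ≤ φ (EE i o o) * φ (EE i o o) := by
      have := star_mul_self_nonneg (φ (EE i o o))
      rwa [hsa] at this
    have hbn : ‖φ (EE i o o) * φ (EE i o o)‖ = ‖φ (EE i o o)‖ * ‖φ (EE i o o)‖ := by
      have := CStarRing.norm_star_mul_self (x := φ (EE i o o))
      rwa [hsa] at this
    have hb0 : φ (EE i o o) * φ (EE i o o) ≠ 0 := by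
      rw [← norm_pos_iff, hbn]; have := hη.trans ho; positivity
    obtain ⟨ψ, hψ, hψ1, hψa⟩ := exists_blockmap (fun k l => apd_EE h i k l o) hb hb0
    refine ⟨ψ, hψ, fun _ => ⟨hψ1, fun a ha => ?_⟩, fun h => absurd ⟨o, ho⟩ h⟩
    refine (hψa a (y a i) ε hε fun ξ => ?_).trans ?_
    · have e1 : ∑ l, ξ l • φ (EE i l o) = φ (∑ l, ξ l • EE i l o) := by simp
      have e2 : ∑ l, ξ l • ∑ k, y a i k l • φ (EE i k o) = φ (y a * ∑ l, ξ l • EE i l o) := by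
        simp [Finset.mul_sum, mul_EE]
      rw [e1, e2, norm_sub_rev]
      refine (hy a ha _).trans (mul_le_mul_of_nonneg_left ?_ hε)
      have e3 := ortho_norm (u := fun l => EE i l o) (b := EE i o o) (fun k l => by
        rw [EE_star, EE_mul]) ξ
      have e4 : ‖EE i o o‖ ≤ 1 := proj_norm_le (by rw [EE_mul, if_pos rfl]) (EE_star _ _ _)
      refine abs_le_of_sq_le_sq' ?_ (norm_nonneg _) |>.2
      exact e3.trans (mul_le_of_le_one_right (by positivity) e4)
    · rw [hbn, Real.sqrt_mul_self (norm_nonneg _)]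
      gcongr
  choose ψ hψ hgood hbad using hex
  set Ψ : D →ₗ[ℂ] Blk (fun i => Fin (r i)) := LinearMap.pi ψ with hΨ
  have hΨcp : IsCompletelyPositive Ψ := cp_pi hψ
  have hΨ1 : Ψ 1 * Ψ 1 = Ψ 1 ∧ star (Ψ 1) = Ψ 1 := by
    constructor
    · ext1 i
      show ψ i 1 * ψ i 1 = ψ i 1
      by_cases hg : ∃ o, η < ‖φ (EE i o o)‖
      · rw [(hgood i hg).1, one_mul]
      · rw [hbad i hg]; simp
    · ext1 i
      show star (ψ i 1) = ψ i 1
      by_cases hg : ∃ o, η < ‖φ (EE i o o)‖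
      · rw [(hgood i hg).1, star_one]
      · rw [hbad i hg]; simp
  refine ⟨Ψ, hΨcp, cp_contr hΨcp (proj_le_one hΨ1.1 hΨ1.2), fun a ha => ?_⟩
  set B : Finset (Fin s) := Finset.univ.filter fun i => ¬ ∃ o, η < ‖φ (EE i o o)‖ with hB
  set Q : Blk (fun i => Fin (r i)) := fun i => if i ∈ B then 1 else 0 with hQ
  have hQn : ‖φ Q‖ ≤ (n + 1) * η := apd_bad h hη.le B (by
    intro i hi o
    simp [hB] at hi
    exact hi o)
  have hQ1 : ‖Q‖ ≤ 1 := proj_norm_le (by ext1 i; by_cases hi : i ∈ B <;> simp [hQ, hi])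
    (by ext1 i; by_cases hi : i ∈ B <;> simp [hQ, hi])
  have e1 : ‖Ψ a - (y a - y a * Q)‖ ≤ ε / η := by
    rw [pi_norm_le_iff_of_nonneg (by positivity)]
    intro i
    show ‖ψ i a - (y a i - y a i * Q i)‖ ≤ ε / η
    by_cases hg : ∃ o, η < ‖φ (EE i o o)‖
    · have : Q i = 0 := by simp only [hQ, hB, Finset.mem_filter]; rw [if_neg]; tauto
      rw [this, mul_zero, sub_zero]
      exact (hgood i hg).2 a ha
    · have : Q i = 1 := by simp only [hQ, hB, Finset.mem_filter]; rw [if_pos]; exact ⟨Finset.mem_univ _, hg⟩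
      rw [this, mul_one, sub_self, hbad i hg]
      simp only [LinearMap.zero_apply, sub_zero, norm_zero]
      positivity
  have e2 := (cp_contr h.cp h.le_one _).trans e1
  have e3 : ‖φ (y a * Q) - a * φ Q‖ ≤ ε :=
    (hy a ha Q).trans (mul_le_of_le_one_right hε hQ1)
  have e4 : ‖φ (y a) - a * φ 1‖ ≤ ε := by
    have := (hy a ha 1).trans (mul_le_of_le_one_right hε norm_one_le')
    rwa [mul_one] at this
  have e5 : ‖a * φ Q‖ ≤ ‖a‖ * ((n + 1) * η) := (norm_mul_le _ _).trans (by gcongr)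
  have e6 : ‖a * (φ 1 - 1)‖ ≤ ‖a‖ * ε := (norm_mul_le _ _).trans (mul_le_mul_of_nonneg_left h.near (norm_nonneg _))
  have e7 : φ (Ψ a) - a = φ (Ψ a - (y a - y a * Q)) - (φ (y a * Q) - a * φ Q) - a * φ Q + (φ (y a) - a * φ 1) + a * (φ 1 - 1) := by
    rw [map_sub, map_sub]; noncomm_ring
  rw [e7]
  refine (norm_add_le _ _).trans (add_le_add ((norm_add_le _ _).trans (add_le_add ((norm_sub_le _ _).trans (add_le_add 
    ((norm_sub_le _ _).trans (add_le_add e2 e3)) e5)) e4)) e6)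

end Final

section Final2
variable {D : Type*} [CStarAlgebra D]

def reidx {I : Type} [Fintype I] {m : I → Type} [∀ i, Fintype (m i)] [∀ i, DecidableEq (m i)] {s : ℕ} (e : I ≃ Fin s)
    {r : Fin s → ℕ} (f : ∀ q, m (e.symm q) ≃ Fin (r q)) : Blk m →⋆ₐ[ℂ] Blk (fun q => Fin (r q)) where
  toFun x := fun q => (x (e.symm q)).submatrix (f q).symm (f q).symm
  map_one' := by ext1 q; simp
  map_mul' x y := by
    ext1 q
    show (x (e.symm q) * y (e.symm q)).submatrix _ _ = _
    rw [Matrix.submatrix_mul_equiv _ _ _ (f q).symm _ |>.symm]; rfl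
  map_zero' := by ext1 q; simp
  map_add' x y := by ext1 q; rfl
  commutes' t := by
    ext q a b
    simp [Algebra.algebraMap_eq_smul_one, Matrix.one_apply]
  map_star' x := by ext1 q; rfl

theorem reidx_bij {I : Type} [Fintype I] {m : I → Type} [∀ i, Fintype (m i)] [∀ i, DecidableEq (m i)] {s : ℕ} (e : I ≃ Fin s)
    {r : Fin s → ℕ} (f : ∀ q, m (e.symm q) ≃ Fin (r q)) : Function.Bijective (reidx e f) := by
  constructor
  · intro x y h
    apply (Equiv.piCongrLeft' (fun i => Matrix (m i) (m i) ℂ) e).injective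
    ext1 q
    show x (e.symm q) = y (e.symm q)
    ext a b
    have := congrFun (congrFun (congrFun h q) (f q a)) (f q b)
    simpa [reidx] using this
  · intro z
    refine ⟨(Equiv.piCongrLeft' (fun i => Matrix (m i) (m i) ℂ) e).symm fun q => (z q).submatrix (f q) (f q), ?_⟩
    ext1 q
    show Matrix.submatrix ((Equiv.piCongrLeft' (fun i => Matrix (m i) (m i) ℂ) e) ((Equiv.piCongrLeft' (fun i => Matrix (m i) (m i) ℂ) e).symm fun q => (z q).submatrix (f q) (f q)) q) _ _ = _
    rw [Equiv.apply_symm_apply]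
    ext a b; simp

theorem AP.reindex {n : ℕ} {K : D → ℝ} {S : Finset D} {ε : ℝ} (h : AP n D K S ε) :
    ∃ (s : ℕ) (r : Fin s → ℕ) (J : Fin s → Fin (n + 1)) (φ : Blk (fun i => Fin (r i)) →ₗ[ℂ] D), APd (cproj J) φ K S ε := by
  obtain ⟨I, _, _, m, _, _, J, φ, h⟩ := h
  let e := Fintype.equivFin I
  let f : ∀ q, m (e.symm q) ≃ Fin (Fintype.card (m (e.symm q))) := fun q => Fintype.equivFin _
  let θ := StarAlgEquiv.ofBijective (reidx e f) (reidx_bij e f)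
  refine ⟨_, fun q => Fintype.card (m (e.symm q)), J ∘ e.symm, _, APd.source θ.symm (c' := cproj (J ∘ e.symm)) (fun j => ?_) h⟩
  rw [← θ.symm_apply_apply (cproj J j)]
  congr 1
  show _ = reidx e f (cproj J j)
  ext1 q
  show (if J (e.symm q) = j then 1 else 0 : Matrix _ _ ℂ) = (if J (e.symm q) = j then 1 else 0 : Matrix _ _ ℂ).submatrix _ _
  split_ifs <;> simp

theorem dr_of_ap {n : ℕ} (h : ∀ (S : Finset D) (ε : ℝ), 0 < ε → ∃ K, AP n D K S ε) : DecompositionRankLE n D := by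
  intro S ε hε
  set M : ℝ := ∑ a ∈ S, ‖a‖ + 1 with hM
  have hM0 : 0 < M := by have : 0 ≤ ∑ a ∈ S, ‖a‖ := Finset.sum_nonneg fun _ _ => norm_nonneg _
                         linarith
  have hSM : ∀ a ∈ S, ‖a‖ ≤ M := fun a ha => by
    have := Finset.single_le_sum (f := fun a : D => ‖a‖) (fun _ _ => norm_nonneg _) ha
    linarith
  obtain ⟨η, hη, hη'⟩ : ∃ η : ℝ, 0 < η ∧ M * ((n + 1) * η) ≤ ε / 4 :=
    ⟨ε / 4 / (M * (n + 1)), by positivity, by apply le_of_eq; field_simp⟩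
  obtain ⟨δ, hδ, hδ'⟩ : ∃ δ : ℝ, 0 < δ ∧ (1 / η + 2 + M) * δ ≤ ε / 4 :=
    ⟨ε / 4 / (1 / η + 2 + M), by positivity, by apply le_of_eq; field_simp⟩
  obtain ⟨K, hK⟩ := h S δ hδ
  obtain ⟨s, r, J, φ, hφ⟩ := hK.reindex
  obtain ⟨ψ, hψ, hψn, hψa⟩ := dr_of_apd hφ hδ.le hη
  refine ⟨s, r, J, ψ, φ, hψ, hφ.cp, hψn, cp_contr hφ.cp hφ.le_one, ?_, ?_⟩
  · intro j e he f hf hef hfe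
    have aux : ∀ x : FDBlock s r, x ∈ blockSupp J j → cproj J j * x = x := by
      intro x hx
      ext1 i
      rw [Pi.mul_apply]
      by_cases hi : J i = j
      · simp [cproj, hi]
      · rw [hx i hi, mul_zero]
    have h1 := hφ.soz j e f
    have h2 := hφ.soz j f e
    rw [aux e he, aux f hf, hef] at h1
    rw [aux e he, aux f hf, hfe] at h2
    simp only [mul_zero, map_zero] at h1 h2
    exact ⟨h1, h2⟩
  · intro a ha
    refine (hψa a ha).trans_lt ?_
    have h1 : ‖a‖ * ((n + 1) * η) ≤ ε / 4 := (mul_le_mul_of_nonneg_right (hSM a ha) (by positivity)).trans hη'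
    have h2 : ‖a‖ * δ ≤ M * δ := mul_le_mul_of_nonneg_right (hSM a ha) hδ.le
    have h3 : δ / η = 1 / η * δ := by ring
    rw [h3]
    linarith
end Final2

open TopologicalSpace in
theorem stmt0 (n : ℕ) (A : Type) [CStarAlgebra A] [SeparableSpace A]
    (hA : IsUnitalLocalAlg (drClass n) A) :
    DecompositionRankLE n A := by
  exact dr_of_ap fun S ε hε => local_ap hA S hε

end
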